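/- There exist constants 0 < c ≤ C < ∞ such that for all integers n ≥ 1 and all integers h with −n ≤ h ≤ 0, c/n ≤ p(h) ≤ C/n, where p(h) is the probability that the highest horizontal open crossing of B(n) exists and the minimal y-coordinate among its vertices equals h; equivalently, p(h) is the probability that there is a horizontal open crossing of [−n,n]×[h,n] but no horizontal open crossing of [−n,n]×[h+1,n]. -/

import Mathlib

/-!
Critical site percolation on the triangular lattice realized on `ℤ²`.
A configuration assigns to each site `true` (open) or `false` (closed),
and `P` is the product Bernoulli(1/2) measure, axiomatized by
`IsBernoulliHalf` below (finite cylinder events have product probability).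
-/

open MeasureTheory
open scoped ENNReal

/-- Sites of the lattice: vertices of `ℤ²`. -/
abbrev Site : Type := ℤ × ℤ

/-- A percolation configuration: `true` = open, `false` = closed. -/
abbrev Config : Type := Site → Bool

/-- Adjacency for the triangular lattice realized on `ℤ²`:
the neighbors of `(x,y)` are `(x±1,y)`, `(x,y±1)`, `(x+1,y-1)`, `(x-1,y+1)`. -/
def Adj (a b : Site) : Prop :=
  (b.1 - a.1, b.2 - a.2) ∈
    ({(1, 0), (-1, 0), (0, 1), (0, -1), (1, -1), (-1, 1)} : Set (ℤ × ℤ))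

/-- A (nonempty, self-avoiding) lattice path: a list of distinct sites in which
consecutive sites are neighbors. -/
def IsPath (p : List Site) : Prop := p ≠ [] ∧ p.Nodup ∧ p.Chain' Adj

/-- A path all of whose vertices lie in the set `S`. -/
def PathIn (S : Set Site) (p : List Site) : Prop := IsPath p ∧ ∀ v ∈ p, v ∈ S

/-- All sites of `p` are open in `ω`. -/
def IsOpenOn (ω : Config) (p : List Site) : Prop := ∀ v ∈ p, ω v = true

/-- All sites of `p` are closed in `ω`. -/
def IsClosedOn (ω : Config) (p : List Site) : Prop := ∀ v ∈ p, ω v = false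

/-- The first vertex of `p` lies in `A`. -/
def FirstIn (A : Set Site) (p : List Site) : Prop := ∃ a ∈ A, p.head? = some a

/-- The last vertex of `p` lies in `A`. -/
def LastIn (A : Set Site) (p : List Site) : Prop := ∃ a ∈ A, p.getLast? = some a

/-- `μ` is the product Bernoulli(1/2) measure on configurations: a probability
measure for which every finite cylinder event has the product probability. -/
def IsBernoulliHalf (μ : Measure Config) : Prop :=
  IsProbabilityMeasure μ ∧
    ∀ (S : Finset Site) (f : Site → Bool),
      μ {ω | ∀ v ∈ S, ω v = f v} = (1 / 2 : ℝ≥0∞) ^ S.card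

/-- The lattice rectangle `[x₀,x₁] × [y₀,y₁]`. -/
def rect (x₀ x₁ y₀ y₁ : ℤ) : Set Site :=
  {v | x₀ ≤ v.1 ∧ v.1 ≤ x₁ ∧ y₀ ≤ v.2 ∧ v.2 ≤ y₁}

/-- The left side of a rectangle. -/
def rectLeft (x₀ x₁ y₀ y₁ : ℤ) : Set Site := {v ∈ rect x₀ x₁ y₀ y₁ | v.1 = x₀}

/-- The right side of a rectangle. -/
def rectRight (x₀ x₁ y₀ y₁ : ℤ) : Set Site := {v ∈ rect x₀ x₁ y₀ y₁ | v.1 = x₁}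

/-- The top side of a rectangle. -/
def rectTop (x₀ x₁ y₀ y₁ : ℤ) : Set Site := {v ∈ rect x₀ x₁ y₀ y₁ | v.2 = y₁}

/-- The bottom side of a rectangle. -/
def rectBot (x₀ x₁ y₀ y₁ : ℤ) : Set Site := {v ∈ rect x₀ x₁ y₀ y₁ | v.2 = y₀}

/-- A horizontal open crossing of the rectangle `[x₀,x₁] × [y₀,y₁]`:
an open path in the rectangle from its left side to its right side. -/
def HorizCrossing (x₀ x₁ y₀ y₁ : ℤ) (ω : Config) (p : List Site) : Prop :=
  PathIn (rect x₀ x₁ y₀ y₁) p ∧ IsOpenOn ω p ∧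
    FirstIn (rectLeft x₀ x₁ y₀ y₁) p ∧ LastIn (rectRight x₀ x₁ y₀ y₁) p

theorem adj_iff {a b : Site} : Adj a b ↔
    (b.1 = a.1 + 1 ∧ b.2 = a.2) ∨ (b.1 = a.1 - 1 ∧ b.2 = a.2) ∨
    (b.1 = a.1 ∧ b.2 = a.2 + 1) ∨ (b.1 = a.1 ∧ b.2 = a.2 - 1) ∨
    (b.1 = a.1 + 1 ∧ b.2 = a.2 - 1) ∨ (b.1 = a.1 - 1 ∧ b.2 = a.2 + 1) := by
  simp only [Adj, Set.mem_insert_iff, Set.mem_singleton_iff, Prod.mk.injEq]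
  omega

theorem Adj.symm {a b : Site} (h : Adj a b) : Adj b a := by
  rw [adj_iff] at *; omega

/-- One step of a lattice path staying inside `S`. -/
def Step (S : Set Site) (u v : Site) : Prop := Adj u v ∧ u ∈ S ∧ v ∈ S

/-- `a` and `b` are joined by a lattice path inside `S`. -/
def Conn (S : Set Site) (a b : Site) : Prop := a ∈ S ∧ Relation.ReflTransGen (Step S) a b

namespace Conn

variable {S S' : Set Site} {a b c : Site}

theorem refl (h : a ∈ S) : Conn S a a := ⟨h, .refl⟩

theorem left_mem (h : Conn S a b) : a ∈ S := h.1

theorem right_mem (h : Conn S a b) : b ∈ S := by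
  obtain ⟨ha, h⟩ := h
  induction h with
  | refl => exact ha
  | tail _ h _ => exact h.2.2

theorem trans (h : Conn S a b) (h' : Conn S b c) : Conn S a c := ⟨h.1, h.2.trans h'.2⟩

theorem step (ha : a ∈ S) (hb : b ∈ S) (h : Adj a b) : Conn S a b := ⟨ha, .single ⟨h, ha, hb⟩⟩

theorem symm (h : Conn S a b) : Conn S b a := by
  obtain ⟨ha, h⟩ := h
  induction h with
  | refl => exact refl ha
  | tail _ h ih => exact (step h.2.2 h.2.1 h.1.symm).trans ih

theorem map {φ : Site → Site} (h : Conn S a b) (hφ : ∀ u v, Adj u v → Adj (φ u) (φ v))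
    (hS : ∀ v ∈ S, φ v ∈ S') : Conn S' (φ a) (φ b) := by
  obtain ⟨ha, h⟩ := h
  induction h with
  | refl => exact refl (hS _ ha)
  | tail _ h ih => exact ih.trans (step (hS _ h.2.1) (hS _ h.2.2) (hφ _ _ h.1))

theorem mono (h : Conn S a b) (hS : S ⊆ S') : Conn S' a b :=
  h.map (φ := id) (fun _ _ h => h) hS

/-- A property preserved along steps holds at every site reached. -/
theorem induct {p : Site → Prop} (h : Conn S a b) (h0 : p a)
    (hs : ∀ u v, p u → u ∈ S → v ∈ S → Adj u v → p v) : p b := by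
  obtain ⟨_, h⟩ := h
  induction h with
  | refl => exact h0
  | tail _ h ih => exact hs _ _ ih h.2.1 h.2.2 h.1

/-- A path stays in the component of its starting point. -/
theorem component (h : Conn S a b) : Conn {v | Conn S a v} a b := by
  obtain ⟨ha, h⟩ := h
  induction h with
  | refl => exact refl (refl ha)
  | tail h' h ih =>
    exact ih.trans (step ⟨ha, h'⟩ ⟨ha, h'.tail h⟩ h.1)

/-- A path from `f ≤ lo` to `f ≥ hi` (up to the step size of `f`) contains a
sub-path inside `lo ≤ f ≤ hi` with the same property. -/
theorem slab {f : Site → ℤ} {k lo hi : ℤ} (hf : ∀ u v, Adj u v → f v < f u + k + 1)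
    (hlh : lo + k - 1 ≤ hi) (h : Conn S a b) (ha : f a < lo + k) (hb : hi - k < f b) :
    ∃ a' b', Conn (S ∩ {v | lo ≤ f v ∧ f v ≤ hi}) a' b' ∧ f a' < lo + k ∧ hi - k < f b' := by
  set G := S ∩ {v | lo ≤ f v ∧ f v ≤ hi} with hG
  have key : (∃ a' b', Conn G a' b' ∧ f a' < lo + k ∧ hi - k < f b') ∨
      (∃ b', Conn G a b' ∧ hi - k < f b') ∨ hi < f a := by
    refine h.symm.induct (p := fun u => (∃ a' b', Conn G a' b' ∧ f a' < lo + k ∧ hi - k < f b') ∨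
      (∃ b', Conn G u b' ∧ hi - k < f b') ∨ hi < f u) ?_ ?_
    · by_cases hbb : f b ≤ hi
      · exact .inr (.inl ⟨b, refl ⟨h.right_mem, by omega, hbb⟩, hb⟩)
      · exact .inr (.inr (by omega))
    · rintro u v hu huS hvS huv
      have h1 := hf _ _ huv
      have h2 := hf _ _ huv.symm
      rcases hu with hu | ⟨b', hb', hb''⟩ | hu
      · exact .inl hu
      · by_cases hv1 : f v < lo
        · exact .inl ⟨u, b', hb', by omega, hb''⟩
        · by_cases hv2 : f v ≤ hi
          · refine .inr (.inl ⟨b', (step (S := G) ⟨hvS, by omega, hv2⟩ hb'.left_mem huv.symm).trans hb', hb''⟩)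
          · exact .inr (.inr (by omega))
      · by_cases hv2 : f v ≤ hi
        · exact .inr (.inl ⟨v, refl ⟨hvS, by omega, hv2⟩, by omega⟩)
        · exact .inr (.inr (by omega))
  rcases key with h | ⟨b', h1, h2⟩ | h
  · exact h
  · exact ⟨a, b', h1, ha, h2⟩
  · omega

/-- Last exit from a set `G` along a path. -/
theorem last_exit {G : Set Site} (h : Conn S a b) (ha : a ∈ G) (hb : b ∉ G) :
    ∃ z ∈ G, ∃ z', Adj z z' ∧ Conn (S \ G) z' b := by
  have key : (∃ z ∈ G, ∃ z', Adj z z' ∧ Conn (S \ G) z' b) ∨ Conn (S \ G) a b := by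
    refine h.symm.induct (p := fun u => (∃ z ∈ G, ∃ z', Adj z z' ∧ Conn (S \ G) z' b) ∨
      Conn (S \ G) u b) (.inr (refl ⟨h.right_mem, hb⟩)) ?_
    rintro u v (hu | hu) huS hvS huv
    · exact .inl hu
    · by_cases hv : v ∈ G
      · exact .inl ⟨v, hv, u, huv.symm, hu⟩
      · exact .inr ((step (S := S \ G) ⟨hvS, hv⟩ hu.left_mem huv.symm).trans hu)
  rcases key with h | h
  · exact h
  · exact absurd ha h.left_mem.2

/-- Horizontal segments are connected. -/
theorem row {x y : ℤ} (n : ℕ) (h : ∀ i : ℤ, 0 ≤ i → i ≤ n → (x + i, y) ∈ S) :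
    Conn S (x, y) (x + n, y) := by
  induction n with
  | zero => simpa using refl (by simpa using h 0 le_rfl (by simp))
  | succ n ih =>
    refine (ih fun i h0 h1 => h i h0 (by push_cast; omega)).trans (step ?_ ?_ ?_)
    · exact h n (by omega) (by push_cast; omega)
    · exact h _ (by omega) le_rfl
    · exact adj_iff.2 (Or.inl ⟨by push_cast; ring, rfl⟩)

/-- Vertical segments are connected. -/
theorem column {x y : ℤ} (n : ℕ) (h : ∀ i : ℤ, 0 ≤ i → i ≤ n → (x, y + i) ∈ S) :
    Conn S (x, y) (x, y + n) := by
  induction n with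
  | zero => simpa using refl (by simpa using h 0 le_rfl (by simp))
  | succ n ih =>
    refine (ih fun i h0 h1 => h i h0 (by push_cast; omega)).trans (step ?_ ?_ ?_)
    · exact h n (by omega) (by push_cast; omega)
    · exact h _ (by omega) le_rfl
    · exact adj_iff.2 (Or.inr (Or.inr (Or.inl ⟨rfl, by push_cast; ring⟩)))

end Conn

/-- The lattice triangle with side `N`. -/
def tri (N : ℕ) : Set Site := {v | 0 ≤ v.1 ∧ 0 ≤ v.2 ∧ v.1 + v.2 ≤ N}

/-- A connected subset of `A` in the triangle touches all three sides. -/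
def YConn (N : ℕ) (A : Set Site) : Prop :=
  ∃ a b c : Site, a.1 = 0 ∧ b.2 = 0 ∧ c.1 + c.2 = (N : ℤ) ∧ Conn (A ∩ tri N) a b ∧ Conn (A ∩ tri N) a c

/-- Sites `v` such that the majority of the upward triangle at `v` lies in `A`. -/
def maj (A : Set Site) : Set Site :=
  {v | (v ∈ A ∧ (v.1 + 1, v.2) ∈ A) ∨ (v ∈ A ∧ (v.1, v.2 + 1) ∈ A) ∨
    ((v.1 + 1, v.2) ∈ A ∧ (v.1, v.2 + 1) ∈ A)}

theorem maj_compl (A : Set Site) : maj Aᶜ = (maj A)ᶜ := by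
  ext v; simp only [maj, Set.mem_ofPred_eq, Set.mem_compl_iff]; tauto

/-- `v` is a corner of the upward triangle at `τ`. -/
def Corner (τ v : Site) : Prop :=
  (v.1 = τ.1 ∧ v.2 = τ.2) ∨ (v.1 = τ.1 + 1 ∧ v.2 = τ.2) ∨ (v.1 = τ.1 ∧ v.2 = τ.2 + 1)

theorem mem_maj_of_corner {A : Set Site} {τ u v : Site} (hu : Corner τ u) (hv : Corner τ v)
    (huA : u ∈ A) (hvA : v ∈ A) (hne : u ≠ v) : τ ∈ maj A := by
  obtain ⟨t1, t2⟩ := τ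
  obtain ⟨u1, u2⟩ := u
  obtain ⟨v1, v2⟩ := v
  simp only [Corner] at hu hv
  simp only [maj, Set.mem_ofPred_eq]
  rcases hu with ⟨rfl, rfl⟩ | ⟨rfl, rfl⟩ | ⟨rfl, rfl⟩ <;>
  rcases hv with ⟨rfl, rfl⟩ | ⟨rfl, rfl⟩ | ⟨rfl, rfl⟩ <;> first | tauto

theorem conn_of_corner_of_corner {B : Set Site} {v τ σ : Site} (hτ : Corner τ v)
    (hσ : Corner σ v) (hτB : τ ∈ B) (hσB : σ ∈ B) : Conn B τ σ := by
  by_cases h : τ = σ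
  · subst h; exact Conn.refl hτB
  · refine Conn.step hτB hσB ?_
    rw [adj_iff]
    simp only [Corner] at hτ hσ
    rw [Prod.ext_iff] at h
    omega

theorem exists_corner_of_adj {u v : Site} (N : ℕ) (hu : u ∈ tri (N + 1)) (hv : v ∈ tri (N + 1))
    (h : Adj u v) : ∃ τ ∈ tri N, Corner τ u ∧ Corner τ v := by
  refine ⟨(min u.1 v.1, min u.2 v.2), ?_⟩
  simp only [tri, Set.mem_ofPred_eq, Corner] at *
  rw [adj_iff] at h
  push_cast at hu hv
  omega

theorem ne_of_adj {u v : Site} (h : Adj u v) : u ≠ v := by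
  rintro rfl; rw [adj_iff] at h; omega

theorem corner_of_conn {N : ℕ} {A : Set Site} {u v τ : Site} (hτ : τ ∈ maj A ∩ tri N)
    (hu : Corner τ u) (h : Conn (A ∩ tri (N + 1)) u v) :
    ∃ σ, Corner σ v ∧ Conn (maj A ∩ tri N) τ σ := by
  refine h.induct (p := fun v => ∃ σ, Corner σ v ∧ Conn (maj A ∩ tri N) τ σ)
    ⟨τ, hu, Conn.refl hτ⟩ ?_
  rintro x y ⟨σ, h1, h2⟩ hx hy hxy
  obtain ⟨ρ, hρ, hρx, hρy⟩ := exists_corner_of_adj N hx.2 hy.2 hxy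
  refine ⟨ρ, hρy, h2.trans (conn_of_corner_of_corner h1 hρx h2.right_mem ⟨?_, hρ⟩)⟩
  exact mem_maj_of_corner hρx hρy hx.1 hy.1 (ne_of_adj hxy)

theorem YConn.down {N : ℕ} {A : Set Site} (h : YConn (N + 1) A) : YConn N (maj A) := by
  obtain ⟨a, b, c, ha, hb, hc, hab, hac⟩ := h
  have hex : ∃ τ ∈ maj A ∩ tri N, Corner τ a := by
    by_contra hno
    have hall : ∀ v, Conn (A ∩ tri (N + 1)) a v → v = a := by
      intro v hv
      refine hv.induct (p := fun v => v = a) rfl ?_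
      rintro x y rfl hx hy hxy
      obtain ⟨ρ, hρ, hρx, hρy⟩ := exists_corner_of_adj N hx.2 hy.2 hxy
      exact absurd ⟨ρ, ⟨mem_maj_of_corner hρx hρy hx.1 hy.1 (ne_of_adj hxy), hρ⟩, hρx⟩ hno
    have h1 := hall b hab
    have h2 := hall c hac
    subst h1 h2
    push_cast at hc
    omega
  obtain ⟨τ, hτ, hτa⟩ := hex
  obtain ⟨σ, hσ, hσ'⟩ := corner_of_conn hτ hτa hab
  obtain ⟨ρ, hρ, hρ'⟩ := corner_of_conn hτ hτa hac
  refine ⟨τ, σ, ρ, ?_, ?_, ?_, hσ', hρ'⟩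
  · have := hτ.2; simp only [tri, Corner, Set.mem_ofPred_eq] at *; omega
  · have := hσ'.right_mem.2; simp only [tri, Corner, Set.mem_ofPred_eq] at *; omega
  · have := hρ'.right_mem.2; simp only [tri, Corner, Set.mem_ofPred_eq] at *; push_cast at hc; omega

theorem tri_of_corner {N : ℕ} {τ v : Site} (hτ : τ ∈ tri N) (h : Corner τ v) : v ∈ tri (N + 1) := by
  simp only [tri, Corner, Set.mem_ofPred_eq] at *; push_cast; omega

theorem exists_common_or_adj {A : Set Site} {τ σ : Site} (hτ : τ ∈ maj A) (hσ : σ ∈ maj A)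
    (h : Adj τ σ) : ∃ u v, Corner τ u ∧ Corner σ v ∧ u ∈ A ∧ v ∈ A ∧ (u = v ∨ Adj u v) := by
  obtain ⟨t1, t2⟩ := τ
  obtain ⟨s1, s2⟩ := σ
  simp only [maj, Set.mem_ofPred_eq] at hτ hσ
  rw [adj_iff] at h
  by_contra hno
  push Not at hno
  have key : ∀ i j k l : ℤ, Corner (t1, t2) (i, j) → Corner (s1, s2) (k, l) → (i, j) ∈ A →
      (k, l) ∈ A → ¬ ((i, j) = (k, l) ∨ Adj (i, j) (k, l)) := fun i j k l h1 h2 h3 h4 h5 => by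
    have := hno _ _ h1 h2 h3 h4
    tauto
  have fin : ∀ i j k l : ℤ, Corner (t1, t2) (i, j) → Corner (s1, s2) (k, l) → (i, j) ∈ A →
      (k, l) ∈ A → (k - i = 0 ∨ k - i = 1 ∨ k - i = -1) → (l - j = 0 ∨ l - j = 1 ∨ l - j = -1) →
      (k - i + (l - j) = 0 ∨ k - i + (l - j) = 1 ∨ k - i + (l - j) = -1) → False := by
    intro i j k l h1 h2 h3 h4 h5 h6 h7
    refine key i j k l h1 h2 h3 h4 ?_
    rw [adj_iff, Prod.mk.injEq]
    omega
  have c1 : ∀ x y : ℤ, Corner (x, y) (x, y) := fun x y => .inl ⟨rfl, rfl⟩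
  have c2 : ∀ x y : ℤ, Corner (x, y) (x + 1, y) := fun x y => .inr (.inl ⟨rfl, rfl⟩)
  have c3 : ∀ x y : ℤ, Corner (x, y) (x, y + 1) := fun x y => .inr (.inr ⟨rfl, rfl⟩)
  clear key hno
  rcases hτ with ⟨a1, a2⟩ | ⟨a1, a2⟩ | ⟨a1, a2⟩ <;> rcases hσ with ⟨b1, b2⟩ | ⟨b1, b2⟩ | ⟨b1, b2⟩ <;>
  rcases h with ⟨h1, h2⟩ | ⟨h1, h2⟩ | ⟨h1, h2⟩ | ⟨h1, h2⟩ | ⟨h1, h2⟩ | ⟨h1, h2⟩ <;> dsimp only at h1 h2 <;>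
  first
  | exact fin _ _ _ _ (by first | exact c1 _ _ | exact c2 _ _)
      (by first | exact c1 _ _ | exact c2 _ _) a1 b1 (by omega) (by omega) (by omega)
  | exact fin _ _ _ _ (by first | exact c1 _ _ | exact c2 _ _)
      (by first | exact c1 _ _ | exact c2 _ _ | exact c3 _ _) a1 b2 (by omega) (by omega) (by omega)
  | exact fin _ _ _ _ (by first | exact c1 _ _ | exact c2 _ _ | exact c3 _ _)
      (by first | exact c1 _ _ | exact c2 _ _) a2 b1 (by omega) (by omega) (by omega)
  | exact fin _ _ _ _ (by first | exact c1 _ _ | exact c2 _ _ | exact c3 _ _)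
      (by first | exact c1 _ _ | exact c2 _ _ | exact c3 _ _) a2 b2 (by omega) (by omega) (by omega)

theorem conn_of_corners {N : ℕ} {A : Set Site} {τ u v : Site} (hτ : τ ∈ tri N)
    (hu : Corner τ u) (hv : Corner τ v) (huA : u ∈ A) (hvA : v ∈ A) :
    Conn (A ∩ tri (N + 1)) u v := by
  by_cases h : u = v
  · subst h; exact Conn.refl ⟨huA, tri_of_corner hτ hu⟩
  · refine Conn.step ⟨huA, tri_of_corner hτ hu⟩ ⟨hvA, tri_of_corner hτ hv⟩ ?_
    rw [adj_iff]
    simp only [Corner] at hu hv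
    rw [Prod.ext_iff] at h
    omega

theorem conn_of_conn_maj {N : ℕ} {A : Set Site} {τ σ u v : Site}
    (h : Conn (maj A ∩ tri N) τ σ) (hu : Corner τ u) (huA : u ∈ A) (hv : Corner σ v)
    (hvA : v ∈ A) : Conn (A ∩ tri (N + 1)) u v := by
  refine h.induct (p := fun σ => ∀ v, Corner σ v → v ∈ A → Conn (A ∩ tri (N + 1)) u v) ?_ ?_ v hv hvA
  · intro v hv hvA
    exact conn_of_corners h.left_mem.2 hu hv huA hvA
  · intro ρ σ ih hρ hσ hadj v hv hvA
    obtain ⟨p, q, hp, hq, hpA, hqA, hpq⟩ := exists_common_or_adj hρ.1 hσ.1 hadj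
    refine (ih p hp hpA).trans (Conn.trans ?_ (conn_of_corners hσ.2 hq hv hqA hvA))
    rcases hpq with rfl | hpq
    · exact Conn.refl ⟨hpA, tri_of_corner hρ.2 hp⟩
    · exact Conn.step ⟨hpA, tri_of_corner hρ.2 hp⟩ ⟨hqA, tri_of_corner hσ.2 hq⟩ hpq

theorem YConn.up {N : ℕ} {A : Set Site} (h : YConn N (maj A)) : YConn (N + 1) A := by
  obtain ⟨a, b, c, ha, hb, hc, hab, hac⟩ := h
  have h1 : ∃ u, Corner a u ∧ u ∈ A ∧ u.1 = 0 := by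
    rcases hab.left_mem.1 with h | h | h
    · exact ⟨_, by simp [Corner], h.1, ha⟩
    · exact ⟨_, by simp [Corner], h.1, ha⟩
    · exact ⟨_, by simp [Corner], h.2, ha⟩
  have h2 : ∃ u, Corner b u ∧ u ∈ A ∧ u.2 = 0 := by
    rcases hab.right_mem.1 with h | h | h
    · exact ⟨_, by simp [Corner], h.1, hb⟩
    · exact ⟨_, by simp [Corner], h.1, hb⟩
    · exact ⟨_, by simp [Corner], h.1, hb⟩
  have h3 : ∃ u, Corner c u ∧ u ∈ A ∧ u.1 + u.2 = (N + 1 : ℕ) := by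
    rcases hac.right_mem.1 with h | h | h
    · exact ⟨_, by simp [Corner], h.2, by push_cast; omega⟩
    · exact ⟨_, by simp [Corner], h.2, by push_cast; omega⟩
    · exact ⟨_, by simp [Corner], h.2, by push_cast; omega⟩
  obtain ⟨u, hu, huA, hu0⟩ := h1
  obtain ⟨v, hv, hvA, hv0⟩ := h2
  obtain ⟨w, hw, hwA, hw0⟩ := h3
  exact ⟨u, v, w, hu0, hv0, hw0, conn_of_conn_maj hab hu huA hv hvA,
    conn_of_conn_maj hac hu huA hw hwA⟩

/-- The game of Y has exactly one winner. -/
theorem yConn_compl (N : ℕ) (A : Set Site) : YConn N Aᶜ ↔ ¬ YConn N A := by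
  induction N generalizing A with
  | zero =>
    have key : ∀ B : Set Site, YConn 0 B ↔ (0, 0) ∈ B := by
      intro B
      constructor
      · rintro ⟨a, b, c, ha, hb, hc, hab, hac⟩
        have h1 := hab.left_mem
        have h2 : a = (0, 0) := by
          have := h1.2
          simp only [tri, Set.mem_ofPred_eq] at this
          push_cast at this
          rw [Prod.ext_iff]; simp only []; omega
        rw [← h2]; exact h1.1
      · intro h
        have : ((0, 0) : Site) ∈ B ∩ tri 0 := ⟨h, by simp [tri]⟩
        exact ⟨(0, 0), (0, 0), (0, 0), rfl, rfl, by simp, Conn.refl this, Conn.refl this⟩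
    rw [key, key]; rfl
  | succ N ih =>
    have key : ∀ B : Set Site, YConn (N + 1) B ↔ YConn N (maj B) :=
      fun B => ⟨YConn.down, YConn.up⟩
    rw [key, key, maj_compl, ih]

theorem Conn.row_le {S : Set Site} {x x' y : ℤ} (hx : x ≤ x')
    (h : ∀ i : ℤ, x ≤ i → i ≤ x' → (i, y) ∈ S) : Conn S (x, y) (x', y) := by
  obtain ⟨n, rfl⟩ := Int.le.dest hx
  exact Conn.row n fun i h0 h1 => h _ (by omega) (by omega)

theorem Conn.column_le {S : Set Site} {x y y' : ℤ} (hy : y ≤ y')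
    (h : ∀ i : ℤ, y ≤ i → i ≤ y' → (x, i) ∈ S) : Conn S (x, y) (x, y') := by
  obtain ⟨n, rfl⟩ := Int.le.dest hy
  exact Conn.column n fun i h0 h1 => h _ (by omega) (by omega)

/-- `A` contains a path in the rectangle joining its bottom to its top. -/
def VertConn (x₀ x₁ y₀ y₁ : ℤ) (A : Set Site) : Prop :=
  ∃ a b : Site, Conn (A ∩ rect x₀ x₁ y₀ y₁) a b ∧ a.2 = y₀ ∧ b.2 = y₁

/-- `A` contains a path in the rectangle joining its left side to its right side. -/
def HorConn (x₀ x₁ y₀ y₁ : ℤ) (A : Set Site) : Prop :=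
  ∃ a b : Site, Conn (A ∩ rect x₀ x₁ y₀ y₁) a b ∧ a.1 = x₀ ∧ b.1 = x₁

theorem horConn_compl_zero {w k : ℕ} (hw : 1 ≤ w) (A : Set Site) :
    HorConn 0 w 0 k Aᶜ ↔ ¬ VertConn 0 w 0 k A := by
  set B : Set Site := (A ∩ rect 0 w 0 k) ∪ {v | (k : ℤ) < v.2} with hB
  have memB : ∀ v : Site, v ∈ B ↔ (v ∈ A ∧ 0 ≤ v.1 ∧ v.1 ≤ w ∧ 0 ≤ v.2 ∧ v.2 ≤ k) ∨ (k : ℤ) < v.2 :=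
    fun v => Iff.rfl
  have memT : ∀ v : Site, v ∈ tri (w + k) ↔ 0 ≤ v.1 ∧ 0 ≤ v.2 ∧ v.1 + v.2 ≤ w + k := by
    intro v; simp [tri]
  have memR : ∀ v : Site, v ∈ rect 0 w 0 k ↔ 0 ≤ v.1 ∧ v.1 ≤ w ∧ 0 ≤ v.2 ∧ v.2 ≤ k :=
    fun v => Iff.rfl
  constructor
  · rintro ⟨a, b, hab, ha, hb⟩ ⟨c, d, hcd, hc, hd⟩
    have hY : YConn (w + k) B := by
      have h1 : Conn (B ∩ tri (w + k)) c d := hcd.mono fun v hv => by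
        have := hv.2; rw [memR] at this
        refine ⟨.inl hv, ?_⟩
        rw [memT]; omega
      have hdR := hcd.right_mem.2; rw [memR] at hdR
      have hrow : ∀ i : ℤ, 0 ≤ i → i ≤ w - 1 → ((i, k + 1) : Site) ∈ B ∩ tri (w + k) := by
        intro i h0 h1
        rw [Set.mem_inter_iff, memB, memT]
        dsimp only
        omega
      have h2 : Conn (B ∩ tri (w + k)) d (max (d.1 - 1) 0, k + 1) := by
        refine Conn.step h1.right_mem (hrow _ (by omega) (by omega)) ?_
        rw [adj_iff]; dsimp only; omega
      refine ⟨(0, k + 1), c, (w - 1, k + 1), rfl, hc, by push_cast; ring, ?_, ?_⟩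
      · refine Conn.trans (Conn.row_le (x' := max (d.1 - 1) 0) (by omega) ?_) (h1.trans h2).symm
        intro i h0 h1; exact hrow i h0 (by omega)
      · exact Conn.row_le (by omega) hrow
    have hY' : YConn (w + k) Bᶜ := by
      have h1 : Conn (Bᶜ ∩ tri (w + k)) a b := hab.mono fun v hv => by
        have := hv.2; rw [memR] at this
        have := hv.1
        rw [Set.mem_inter_iff, Set.mem_compl_iff, memT, memB]
        rw [Set.mem_compl_iff] at this
        exact ⟨by rintro (h | h) <;> [exact this h.1; omega], by omega⟩
      have hbR := hab.right_mem.2; rw [memR] at hbR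
      rcases Nat.eq_zero_or_pos k with hk | hk
      · exact ⟨a, b, b, ha, by omega, by push_cast; omega, h1, h1⟩
      have hcol : ∀ i : ℤ, 0 ≤ i → i ≤ k - 1 → ((w + 1, i) : Site) ∈ Bᶜ ∩ tri (w + k) := by
        intro i h0 h1
        rw [Set.mem_inter_iff, Set.mem_compl_iff, memB, memT]
        dsimp only
        exact ⟨by rintro (h | h) <;> omega, by omega⟩
      have h2 : Conn (Bᶜ ∩ tri (w + k)) b (w + 1, max (b.2 - 1) 0) := by
        refine Conn.step h1.right_mem (hcol _ (by omega) (by omega)) ?_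
        rw [adj_iff]; dsimp only; omega
      have h3 := h1.trans h2
      refine ⟨a, (w + 1, 0), (w + 1, k - 1), ha, rfl, by push_cast; ring, ?_, ?_⟩
      · refine h3.trans (Conn.symm (Conn.column_le (by omega) ?_))
        intro i h0 h1; exact hcol i h0 (by omega)
      · refine h3.trans (Conn.column_le (by omega) ?_)
        intro i h0 h1; exact hcol i (by omega) h1
    exact (yConn_compl _ _).1 hY' hY
  · intro hV
    by_cases hY : YConn (w + k) B
    · refine absurd ?_ hV
      obtain ⟨a, b, c, ha, hb, hc, hab, hac⟩ := hY
      have hcB := (memB c).1 hac.right_mem.1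
      push_cast at hc
      obtain ⟨u, v, huv, hu, hv⟩ := (hab.symm.trans hac).slab (f := Prod.snd) (k := 1) (lo := 0)
        (hi := k) (by intro u v h; rw [adj_iff] at h; omega) (by omega) (by omega) (by omega)
      have h1 : Conn (A ∩ rect 0 w 0 k) u v := huv.mono fun z hz => by
        have h1 := (memB z).1 hz.1.1
        have h2 := hz.2
        simp only [Set.mem_ofPred_eq] at h2
        rcases h1 with h1 | h1
        · exact ⟨h1.1, h1.2⟩
        · omega
      refine ⟨u, v, h1, ?_, ?_⟩
      · have := (memR _).1 h1.left_mem.2; omega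
      · have := (memR _).1 h1.right_mem.2; omega
    · obtain ⟨a, b, c, ha, hb, hc, hab, hac⟩ := (yConn_compl _ _).2 hY
      have hcB := hac.right_mem.1
      rw [Set.mem_compl_iff, memB] at hcB
      push_cast at hc
      obtain ⟨u, v, huv, hu, hv⟩ := hac.slab (f := Prod.fst) (k := 1) (lo := 0)
        (hi := w) (by intro u v h; rw [adj_iff] at h; omega) (by omega) (by omega) (by omega)
      have h1 : Conn (Aᶜ ∩ rect 0 w 0 k) u v := huv.mono fun z hz => by
        have h1 := hz.1.1
        have h2 := hz.2
        have h3 := (memT z).1 hz.1.2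
        rw [Set.mem_compl_iff, memB] at h1
        simp only [Set.mem_ofPred_eq] at h2
        have h4 : z.2 ≤ k := by omega
        exact ⟨fun h => h1 (.inl ⟨h, by omega⟩), h2.1, h2.2, h3.2.1, h4⟩
      refine ⟨u, v, h1, ?_, ?_⟩
      · have := (memR _).1 h1.left_mem.2; omega
      · have := (memR _).1 h1.right_mem.2; omega

theorem adj_translate (x y : ℤ) {u v : Site} (h : Adj u v) :
    Adj (u.1 + x, u.2 + y) (v.1 + x, v.2 + y) := by
  rw [adj_iff] at *; dsimp only; omega

/-- Hex: there is a left-right crossing in the complement iff there is no bottom-top crossing. -/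
theorem horConn_compl {x₀ x₁ y₀ y₁ : ℤ} (hx : x₀ < x₁) (hy : y₀ ≤ y₁) (A : Set Site) :
    HorConn x₀ x₁ y₀ y₁ Aᶜ ↔ ¬ VertConn x₀ x₁ y₀ y₁ A := by
  obtain ⟨w, rfl⟩ := Int.le.dest hx.le
  obtain ⟨k, rfl⟩ := Int.le.dest hy
  have key := horConn_compl_zero (w := w) (k := k) (by omega) {v | (v.1 + x₀, v.2 + y₀) ∈ A}
  have e1 : ∀ B : Set Site, ∀ a b, Conn (B ∩ rect x₀ (x₀ + w) y₀ (y₀ + k)) a b →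
      Conn ({v | (v.1 + x₀, v.2 + y₀) ∈ B} ∩ rect 0 w 0 k) (a.1 + -x₀, a.2 + -y₀)
        (b.1 + -x₀, b.2 + -y₀) := by
    intro B a b h
    refine h.map (φ := fun v => (v.1 + -x₀, v.2 + -y₀)) (fun u v => adj_translate _ _) ?_
    rintro v ⟨h1, h2⟩
    refine ⟨by simpa using h1, ?_⟩
    simp only [rect, Set.mem_ofPred_eq] at *
    omega
  have e2 : ∀ B : Set Site, ∀ a b, Conn ({v | (v.1 + x₀, v.2 + y₀) ∈ B} ∩ rect 0 w 0 k) a b →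
      Conn (B ∩ rect x₀ (x₀ + w) y₀ (y₀ + k)) (a.1 + x₀, a.2 + y₀) (b.1 + x₀, b.2 + y₀) := by
    intro B a b h
    refine h.map (φ := fun v => (v.1 + x₀, v.2 + y₀)) (fun u v => adj_translate _ _) ?_
    rintro v ⟨h1, h2⟩
    refine ⟨by simpa using h1, ?_⟩
    simp only [rect, Set.mem_ofPred_eq] at *
    omega
  have hH : HorConn x₀ (x₀ + w) y₀ (y₀ + k) Aᶜ ↔
      HorConn 0 w 0 k {v | (v.1 + x₀, v.2 + y₀) ∈ A}ᶜ := by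
    constructor
    · rintro ⟨a, b, hab, ha, hb⟩
      exact ⟨_, _, e1 _ _ _ hab, by dsimp only; omega, by dsimp only; omega⟩
    · rintro ⟨a, b, hab, ha, hb⟩
      exact ⟨_, _, e2 Aᶜ _ _ hab, by dsimp only; omega, by dsimp only; omega⟩
  have hV : VertConn x₀ (x₀ + w) y₀ (y₀ + k) A ↔
      VertConn 0 w 0 k {v | (v.1 + x₀, v.2 + y₀) ∈ A} := by
    constructor
    · rintro ⟨a, b, hab, ha, hb⟩
      exact ⟨_, _, e1 _ _ _ hab, by dsimp only; omega, by dsimp only; omega⟩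
    · rintro ⟨a, b, hab, ha, hb⟩
      exact ⟨_, _, e2 A _ _ hab, by dsimp only; omega, by dsimp only; omega⟩
  rw [hH, hV, key]

/-- Lattice rectangle in the triangular embedding: the horizontal coordinate is `2x + y`. -/
def trect (y₀ y₁ c d : ℤ) : Set Site :=
  {v | y₀ ≤ v.2 ∧ v.2 ≤ y₁ ∧ c ≤ 2 * v.1 + v.2 ∧ 2 * v.1 + v.2 ≤ d}

/-- Bottom-top crossing of `trect`. -/
def TV (y₀ y₁ c d : ℤ) (A : Set Site) : Prop :=
  ∃ a b : Site, Conn (A ∩ trect y₀ y₁ c d) a b ∧ a.2 = y₀ ∧ b.2 = y₁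

/-- Left-right crossing of `trect`. -/
def TH (y₀ y₁ c d : ℤ) (A : Set Site) : Prop :=
  ∃ a b : Site, Conn (A ∩ trect y₀ y₁ c d) a b ∧ 2 * a.1 + a.2 ≤ c + 1 ∧ d - 1 ≤ 2 * b.1 + b.2

theorem th_compl {y₀ y₁ c d : ℤ} (hy : y₀ ≤ y₁) (hcd : c + 1 ≤ d) (A : Set Site) :
    TH y₀ y₁ c d Aᶜ ↔ ¬ TV y₀ y₁ c d A := by
  obtain ⟨M, hM⟩ : ∃ M : ℤ, M = |y₀| + |y₁| + |c| + |d| + 5 := ⟨_, rfl⟩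
  have hy0 := neg_abs_le y₀
  have hy0' := le_abs_self y₀
  have hy1 := neg_abs_le y₁
  have hy1' := le_abs_self y₁
  have hc := neg_abs_le c
  have hc' := le_abs_self c
  have hd := neg_abs_le d
  have hd' := le_abs_self d
  have key := horConn_compl (x₀ := -M) (x₁ := M) (by omega) hy (A ∩ trect y₀ y₁ c d)
  have sub : trect y₀ y₁ c d ⊆ rect (-M) M y₀ y₁ := by
    intro v hv
    simp only [trect, rect, Set.mem_ofPred_eq] at *
    omega
  have hV : VertConn (-M) M y₀ y₁ (A ∩ trect y₀ y₁ c d) ↔ TV y₀ y₁ c d A := by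
    unfold VertConn TV
    rw [Set.inter_assoc, Set.inter_eq_left.2 sub]
  rw [← hV, ← key]
  constructor
  · rintro ⟨a, b, hab, ha, hb⟩
    have haT := hab.left_mem.2
    have hbT := hab.right_mem.2
    simp only [trect, Set.mem_ofPred_eq] at haT hbT
    have out : ∀ v ∈ rect (-M) M y₀ y₁, 2 * v.1 + v.2 < c ∨ d < 2 * v.1 + v.2 →
        v ∈ (A ∩ trect y₀ y₁ c d)ᶜ ∩ rect (-M) M y₀ y₁ := by
      intro v hv h
      refine ⟨fun h' => ?_, hv⟩
      have := h'.2
      simp only [trect, Set.mem_ofPred_eq] at this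
      omega
    have h0 : Conn ((A ∩ trect y₀ y₁ c d)ᶜ ∩ rect (-M) M y₀ y₁) a b :=
      hab.mono fun v hv => ⟨fun h => hv.1 h.1, sub hv.2⟩
    have h1 : Conn ((A ∩ trect y₀ y₁ c d)ᶜ ∩ rect (-M) M y₀ y₁) (-M, a.2) (a.1 - 1, a.2) := by
      refine Conn.row_le (by omega) fun i h0 h1 => out _ ?_ ?_
      · simp only [rect, Set.mem_ofPred_eq]; omega
      · dsimp only; omega
    have h2 : Conn ((A ∩ trect y₀ y₁ c d)ᶜ ∩ rect (-M) M y₀ y₁) (b.1 + 1, b.2) (M, b.2) := by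
      refine Conn.row_le (by omega) fun i h0 h1 => out _ ?_ ?_
      · simp only [rect, Set.mem_ofPred_eq]; omega
      · dsimp only; omega
    refine ⟨_, _, ((h1.trans (Conn.step h1.right_mem h0.left_mem ?_)).trans h0).trans
      ((Conn.step h0.right_mem h2.left_mem ?_).trans h2), rfl, rfl⟩
    · rw [adj_iff]; dsimp only; omega
    · rw [adj_iff]; dsimp only; omega
  · rintro ⟨a, b, hab, ha, hb⟩
    have haT := hab.left_mem.2
    have hbT := hab.right_mem.2
    simp only [rect, Set.mem_ofPred_eq] at haT hbT
    obtain ⟨u, v, huv, hu, hv⟩ := hab.slab (f := fun v => 2 * v.1 + v.2) (k := 2) (lo := c)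
        (hi := d) (by intro u v h; rw [adj_iff] at h; omega) (by omega)
        (by omega) (by omega)
    refine ⟨u, v, huv.mono fun z hz => ?_, by omega, by omega⟩
    have h1 := hz.1.2
    have h2 := hz.2
    simp only [rect, Set.mem_ofPred_eq] at h1 h2
    have h3 : z ∈ trect y₀ y₁ c d := ⟨by omega, by omega, by omega, by omega⟩
    exact ⟨fun h => hz.1.1 ⟨h, h3⟩, h3⟩

theorem horConn_iff {x₀ x₁ y₀ y₁ : ℤ} (hx : x₀ < x₁) (hy : y₀ ≤ y₁) (A : Set Site) :
    HorConn x₀ x₁ y₀ y₁ A ↔ ¬ VertConn x₀ x₁ y₀ y₁ Aᶜ := by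
  rw [← horConn_compl hx hy, compl_compl]

theorem th_iff {y₀ y₁ c d : ℤ} (hy : y₀ ≤ y₁) (hcd : c + 1 ≤ d) (A : Set Site) :
    TH y₀ y₁ c d A ↔ ¬ TV y₀ y₁ c d Aᶜ := by
  rw [← th_compl hy hcd, compl_compl]

/-- The event `E` about the set of open sites depends only on the sites in `S`. -/
def Dep (S : Set Site) (E : Set Site → Prop) : Prop := ∀ A B, A ∩ S = B ∩ S → E A → E B

theorem Dep.mono {S T : Set Site} {E : Set Site → Prop} (h : Dep S E) (hST : S ⊆ T) : Dep T E := by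
  intro A B hAB
  refine h A B ?_
  have := congrArg (· ∩ S) hAB
  simpa only [Set.inter_assoc, Set.inter_eq_right.2 hST] using this

theorem Dep.not {S : Set Site} {E : Set Site → Prop} (h : Dep S E) : Dep S fun A => ¬ E A :=
  fun A B hAB hA hB => hA (h B A hAB.symm hB)

theorem Dep.and {S : Set Site} {E F : Set Site → Prop} (h : Dep S E) (h' : Dep S F) :
    Dep S fun A => E A ∧ F A :=
  fun A B hAB hA => ⟨h A B hAB hA.1, h' A B hAB hA.2⟩

theorem Dep.preimage {S : Set Site} {E : Set Site → Prop} (h : Dep S E) (φ : Site ≃ Site) :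
    Dep (φ '' S) fun A => E (φ ⁻¹' A) := by
  intro A B hAB
  refine h _ _ ?_
  have := congrArg (φ ⁻¹' ·) hAB
  simpa only [Set.preimage_inter, Equiv.preimage_image] using this

theorem Dep.compl {S : Set Site} {E : Set Site → Prop} (h : Dep S E) : Dep S fun A => E Aᶜ := by
  intro A B hAB
  refine h _ _ ?_
  ext v
  have := congrArg (v ∈ ·) hAB
  simp only [Set.mem_inter_iff, Set.mem_compl_iff, eq_iff_iff] at this ⊢
  tauto

theorem dep_inter {S : Set Site} (F : Set Site → Prop) : Dep S fun A => F (A ∩ S) := by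
  intro A B hAB h
  simpa only [hAB] using h

/-- Probability of an event about the set of open sites. -/
noncomputable def pr (μ : Measure Config) (E : Set Site → Prop) : ℝ :=
  μ.real {ω | E {v | ω v = true}}

section Counting

open scoped Classical in
/-- Number of subsets of `Λ` satisfying `E`. -/
noncomputable def cnt (Λ : Finset Site) (E : Set Site → Prop) : ℕ :=
  (Λ.powerset.filter fun A : Finset Site => E ↑A).card

variable {μ : Measure Config}

theorem measurableSet_of_dep {S : Set Site} (hS : S.Finite) {E : Set Site → Prop} (h : Dep S E) :
    MeasurableSet {ω : Config | E {v | ω v = true}} := by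
  have : {ω : Config | E {v | ω v = true}} =
      ⋃ A ∈ {A : Set Site | A ⊆ S ∧ E A}, ⋂ v ∈ S, {ω : Config | ω v = true ↔ v ∈ A} := by
    ext ω
    simp only [Set.mem_ofPred_eq, Set.mem_iUnion, Set.mem_iInter, exists_prop]
    constructor
    · intro hE
      refine ⟨{v | ω v = true} ∩ S, ⟨Set.inter_subset_right, h _ _ ?_ hE⟩, ?_⟩
      · rw [Set.inter_assoc, Set.inter_self]
      · intro v hv; simp [hv]
    · rintro ⟨A, ⟨hA, hE⟩, hω⟩
      refine h _ _ ?_ hE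
      ext v
      simp only [Set.mem_inter_iff, Set.mem_ofPred_eq]
      constructor
      · rintro ⟨h1, h2⟩; exact ⟨(hω v h2).2 h1, h2⟩
      · rintro ⟨h1, h2⟩; exact ⟨(hω v h2).1 h1, h2⟩
  rw [this]
  refine Set.Finite.measurableSet_biUnion ?_ fun A _ => ?_
  · exact hS.finite_subsets.subset fun A hA => hA.1
  refine Set.Finite.measurableSet_biInter hS fun v _ => ?_
  have hm : MeasurableSet {b : Bool | b = true ↔ v ∈ A} := trivial
  exact (measurable_pi_apply (X := fun _ : Site => Bool) v) hm

theorem pr_mono (hμ : IsBernoulliHalf μ) {E F : Set Site → Prop} (h : ∀ A, E A → F A) :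
    pr μ E ≤ pr μ F := by
  have := hμ.1
  exact measureReal_mono fun ω hω => h _ hω

theorem pr_congr {E F : Set Site → Prop} (h : ∀ A, E A ↔ F A) : pr μ E = pr μ F := by
  have : E = F := funext fun A => propext (h A)
  rw [this]

theorem pr_nonneg (E : Set Site → Prop) : 0 ≤ pr μ E := measureReal_nonneg

theorem pr_le_one (hμ : IsBernoulliHalf μ) (E : Set Site → Prop) : pr μ E ≤ 1 := by
  have := hμ.1
  exact measureReal_le_one

theorem pr_not (hμ : IsBernoulliHalf μ) {S : Set Site} (hS : S.Finite) {E : Set Site → Prop}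
    (h : Dep S E) : pr μ (fun A => ¬ E A) = 1 - pr μ E := by
  have := hμ.1
  exact probReal_compl_eq_one_sub (measurableSet_of_dep hS h)

theorem pr_or_le (E F : Set Site → Prop) : pr μ (fun A => E A ∨ F A) ≤ pr μ E + pr μ F :=
  measureReal_union_le _ _

theorem pr_exists_eq_sum (hμ : IsBernoulliHalf μ) {ι : Type*} (I : Finset ι)
    {E : ι → Set Site → Prop} (S : ι → Set Site) (hS : ∀ i ∈ I, (S i).Finite)
    (hE : ∀ i ∈ I, Dep (S i) (E i)) (hd : ∀ i ∈ I, ∀ j ∈ I, i ≠ j → ∀ A, E i A → ¬ E j A) :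
    pr μ (fun A => ∃ i ∈ I, E i A) = ∑ i ∈ I, pr μ (E i) := by
  have := hμ.1
  unfold pr
  rw [← measureReal_biUnion_finset]
  · congr 1
    ext ω
    simp
  · intro i hi j hj hij
    exact Set.disjoint_left.2 fun ω h1 h2 => hd i hi j hj hij _ h1 h2
  · intro i hi
    exact measurableSet_of_dep (hS i hi) (hE i hi)

theorem pr_exists_le_sum {ι : Type*} (I : Finset ι)
    {E : ι → Set Site → Prop} :
    pr μ (fun A => ∃ i ∈ I, E i A) ≤ ∑ i ∈ I, pr μ (E i) := by
  unfold pr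
  refine le_trans (le_of_eq ?_) (measureReal_biUnion_finset_le I _)
  congr 1
  ext ω
  simp

theorem pr_cylinder (hμ : IsBernoulliHalf μ) (Λ A : Finset Site) (hA : A ⊆ Λ) :
    pr μ (fun B => B ∩ ↑Λ = ↑A) = (1 / 2) ^ Λ.card := by
  classical
  have h := hμ.2 Λ fun v => decide (v ∈ A)
  unfold pr Measure.real
  have e : {ω : Config | ({v | ω v = true} ∩ ↑Λ : Set Site) = ↑A} =
      {ω | ∀ v ∈ Λ, ω v = decide (v ∈ A)} := by
    ext ω
    simp only [Set.mem_ofPred_eq, Set.ext_iff, Set.mem_inter_iff, Finset.mem_coe]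
    constructor
    · intro h v hv
      have := h v
      by_cases hvA : v ∈ A <;> simp_all
    · intro h v
      constructor
      · rintro ⟨h1, h2⟩
        have := h v h2
        simp_all
      · intro hv
        have := h v (hA hv)
        exact ⟨by simp_all, hA hv⟩
  rw [e, h]
  simp

theorem pr_eq_cnt (hμ : IsBernoulliHalf μ) {Λ : Finset Site} {E : Set Site → Prop}
    (h : Dep ↑Λ E) : pr μ E = cnt Λ E / 2 ^ Λ.card := by
  classical
  have e : pr μ E = pr μ (fun B => ∃ A ∈ Λ.powerset.filter (fun A : Finset Site => E ↑A), B ∩ ↑Λ = ↑A) := by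
    refine pr_congr fun B => ⟨fun hB => ⟨Λ.filter (· ∈ B), ?_, ?_⟩, ?_⟩
    · rw [Finset.mem_filter, Finset.mem_powerset]
      refine ⟨Finset.filter_subset _ _, h B _ ?_ hB⟩
      ext v; simp; tauto
    · ext v; simp; tauto
    · rintro ⟨A, hA, hAB⟩
      rw [Finset.mem_filter, Finset.mem_powerset] at hA
      refine h _ _ ?_ hA.2
      rw [hAB]
      exact Set.inter_eq_left.2 (Finset.coe_subset.2 hA.1)
  rw [e, pr_exists_eq_sum hμ _ (fun _ => ↑Λ) (fun _ _ => Λ.finite_toSet)]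
  · rw [Finset.sum_congr rfl fun A hA => pr_cylinder hμ Λ A
      (Finset.mem_powerset.1 (Finset.mem_filter.1 hA).1), Finset.sum_const, cnt, nsmul_eq_mul,
      one_div, inv_pow, div_eq_mul_inv]
  · intro A _
    exact dep_inter fun B => B = ↑A
  · rintro A _ B _ hAB C h1 h2
    exact hAB (Finset.coe_injective (h1.symm.trans h2))

theorem cnt_bij {Λ Λ' : Finset Site} {E F : Set Site → Prop} (i : Finset Site → Finset Site)
    (j : Finset Site → Finset Site) (hi : ∀ A, A ⊆ Λ → E ↑A → i A ⊆ Λ' ∧ F ↑(i A))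
    (hj : ∀ A, A ⊆ Λ' → F ↑A → j A ⊆ Λ ∧ E ↑(j A)) (hji : ∀ A, A ⊆ Λ → j (i A) = A)
    (hij : ∀ A, A ⊆ Λ' → i (j A) = A) : cnt Λ E = cnt Λ' F := by
  classical
  refine Finset.card_nbij' i j ?_ ?_ ?_ ?_
  · intro A hA
    simp only [Finset.coe_filter, Finset.mem_powerset, Set.mem_ofPred_eq] at hA ⊢
    exact hi A hA.1 hA.2
  · intro A hA
    simp only [Finset.coe_filter, Finset.mem_powerset, Set.mem_ofPred_eq] at hA ⊢
    exact hj A hA.1 hA.2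
  · intro A hA
    simp only [Finset.coe_filter, Finset.mem_powerset, Set.mem_ofPred_eq] at hA ⊢
    exact hji A hA.1
  · intro A hA
    simp only [Finset.coe_filter, Finset.mem_powerset, Set.mem_ofPred_eq] at hA ⊢
    exact hij A hA.1

theorem pr_compl (hμ : IsBernoulliHalf μ) {S : Set Site} (hS : S.Finite) {E : Set Site → Prop}
    (h : Dep S E) : pr μ (fun A => E Aᶜ) = pr μ E := by
  classical
  lift S to Finset Site using hS
  rw [pr_eq_cnt hμ h, pr_eq_cnt hμ h.compl]
  congr 2
  refine cnt_bij (fun A => S \ A) (fun A => S \ A) (fun A hA hE => ⟨Finset.sdiff_subset, ?_⟩)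
    (fun A hA hE => ⟨Finset.sdiff_subset, ?_⟩) (fun A hA => ?_) (fun A hA => ?_)
  · refine h _ _ ?_ hE
    ext v; simp; tauto
  · refine h _ _ ?_ hE
    ext v; simp; tauto
  · exact Finset.sdiff_sdiff_eq_self hA
  · exact Finset.sdiff_sdiff_eq_self hA

theorem pr_preimage (hμ : IsBernoulliHalf μ) {S : Set Site} (hS : S.Finite) {E : Set Site → Prop}
    (h : Dep S E) (φ : Site ≃ Site) : pr μ (fun A => E (φ ⁻¹' A)) = pr μ E := by
  classical
  lift S to Finset Site using hS
  have h' : Dep ↑(S.map φ.toEmbedding) fun A => E (φ ⁻¹' A) := by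
    rw [Finset.coe_map]; exact h.preimage φ
  rw [pr_eq_cnt hμ h, pr_eq_cnt hμ h', Finset.card_map]
  congr 2
  refine cnt_bij (fun A => A.map φ.symm.toEmbedding) (fun A => A.map φ.toEmbedding)
    (fun A hA hE => ⟨?_, ?_⟩) (fun A hA hE => ⟨Finset.map_subset_map.2 hA, ?_⟩) (fun A hA => ?_)
    (fun A hA => ?_)
  · refine (Finset.map_subset_map.2 hA).trans (le_of_eq ?_)
    ext v; simp
  · convert hE using 1
    ext v; simp
  · convert hE using 1
    ext v; simp
  · ext v; simp
  · ext v; simp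

theorem pr_and_of_disjoint (hμ : IsBernoulliHalf μ) {S T : Set Site} (hS : S.Finite)
    (hT : T.Finite) (hST : Disjoint S T) {E F : Set Site → Prop} (hE : Dep S E) (hF : Dep T F) :
    pr μ (fun A => E A ∧ F A) = pr μ E * pr μ F := by
  classical
  lift S to Finset Site using hS
  lift T to Finset Site using hT
  rw [Finset.disjoint_coe] at hST
  have hEF : Dep ↑(S ∪ T) fun A => E A ∧ F A := by
    refine (hE.mono ?_).and (hF.mono ?_) <;> simp
  rw [pr_eq_cnt hμ hE, pr_eq_cnt hμ hF, pr_eq_cnt hμ hEF, Finset.card_union_of_disjoint hST,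
    pow_add, div_mul_div_comm]
  congr 1
  rw [← Nat.cast_mul]
  congr 1
  unfold cnt
  rw [← Finset.card_product]
  refine Finset.card_nbij' (fun A => (A ∩ S, A ∩ T)) (fun p => p.1 ∪ p.2) ?_ ?_ ?_ ?_
  · intro A hA
    simp only [Finset.coe_filter, Finset.mem_powerset, Set.mem_ofPred_eq, Finset.coe_product,
      Set.mem_prod] at hA ⊢
    refine ⟨⟨Finset.inter_subset_right, hE _ _ ?_ hA.2.1⟩,
      ⟨Finset.inter_subset_right, hF _ _ ?_ hA.2.2⟩⟩
    · ext v; simp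
    · ext v; simp
  · rintro ⟨A, B⟩ hAB
    simp only [Finset.coe_filter, Finset.mem_powerset, Set.mem_ofPred_eq, Finset.coe_product,
      Set.mem_prod] at hAB ⊢
    refine ⟨Finset.union_subset_union hAB.1.1 hAB.2.1, hE _ _ ?_ hAB.1.2, hF _ _ ?_ hAB.2.2⟩
    · ext v
      have h1 := @hAB.2.1 v
      have h2 : v ∈ S → v ∉ T := fun h => Finset.disjoint_left.1 hST h
      simp; tauto
    · ext v
      have h1 := @hAB.1.1 v
      have h2 : v ∈ S → v ∉ T := fun h => Finset.disjoint_left.1 hST h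
      simp; tauto
  · intro A hA
    simp only [Finset.coe_filter, Finset.mem_powerset, Set.mem_ofPred_eq] at hA
    ext v
    have := @hA.1 v
    simp at this ⊢; tauto
  · rintro ⟨A, B⟩ hAB
    simp only [Finset.coe_filter, Finset.mem_powerset, Set.mem_ofPred_eq, Finset.coe_product,
      Set.mem_prod] at hAB
    ext v
    · have h1 := @hAB.2.1 v
      have h3 := @hAB.1.1 v
      have h2 : v ∈ S → v ∉ T := fun h => Finset.disjoint_left.1 hST h
      simp; tauto
    · have h1 := @hAB.2.1 v
      have h3 := @hAB.1.1 v
      have h2 : v ∈ S → v ∉ T := fun h => Finset.disjoint_left.1 hST h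
      simp; tauto

/-- Positive association of increasing events. -/
theorem pr_mul_le_and (hμ : IsBernoulliHalf μ) {S : Set Site} (hS : S.Finite)
    {E F : Set Site → Prop} (hE : Dep S E) (hF : Dep S F) (hE' : Monotone E) (hF' : Monotone F) :
    pr μ E * pr μ F ≤ pr μ (fun A => E A ∧ F A) := by
  classical
  have key : pr μ (fun A => ¬ E A) * pr μ (fun A => ¬ F A) ≤ pr μ (fun A => ¬ E A ∧ ¬ F A) := by
    lift S to Finset Site using hS
    rw [pr_eq_cnt hμ hE.not, pr_eq_cnt hμ hF.not, pr_eq_cnt hμ (hE.not.and hF.not),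
      div_mul_div_comm, div_le_div_iff₀ (by positivity) (by positivity)]
    have low : ∀ G : Set Site → Prop, Monotone G →
        IsLowerSet (↑(S.powerset.filter fun A : Finset Site => ¬ G ↑A) : Set (Finset Site)) := by
      intro G hG A B hBA hA
      simp only [Finset.coe_filter, Finset.mem_powerset, Set.mem_ofPred_eq] at hA ⊢
      exact ⟨le_trans hBA hA.1, fun h => hA.2 (hG (Finset.coe_subset.2 hBA) h)⟩
    have hk := (low E hE').le_card_inter_finset' (low F hF') (s := S)
      (fun t ht => Finset.mem_powerset.1 (Finset.mem_filter.1 ht).1)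
      (fun t ht => Finset.mem_powerset.1 (Finset.mem_filter.1 ht).1)
    rw [← Finset.filter_and] at hk
    have hk' : (cnt S (fun A => ¬ E A) : ℝ) * cnt S (fun A => ¬ F A) ≤
        2 ^ S.card * cnt S (fun A => ¬ E A ∧ ¬ F A) := by
      have hk2 : cnt S (fun A => ¬ E A) * cnt S (fun A => ¬ F A) ≤
          2 ^ S.card * cnt S (fun A => ¬ E A ∧ ¬ F A) := by
        unfold cnt
        convert hk
      exact_mod_cast hk2
    calc _ ≤ (2 ^ S.card * cnt S (fun A => ¬ E A ∧ ¬ F A) : ℝ) * 2 ^ S.card := by gcongr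
      _ = _ := by ring
  have h1 := pr_not hμ hS hE
  have h2 := pr_not hμ hS hF
  have h3 := pr_not hμ hS (hE.and hF)
  have h4 : pr μ (fun A => ¬ (E A ∧ F A)) + pr μ (fun A => ¬ E A ∧ ¬ F A) =
      pr μ (fun A => ¬ E A) + pr μ (fun A => ¬ F A) := by
    have := hμ.1
    have h := measureReal_union_add_inter (μ := μ) (s := {ω | ¬ E {v | ω v = true}})
      (t := {ω | ¬ F {v | ω v = true}}) (measurableSet_of_dep hS hF.not)
    unfold pr
    rw [← h]
    congr 2
    ext ω
    simp only [Set.mem_ofPred_eq, Set.mem_union]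
    tauto
  rw [h1, h2] at key
  nlinarith

/-- Disjoint occurrence. -/
def Disj (E F : Set Site → Prop) (A : Set Site) : Prop :=
  ∃ s t : Set Site, s ⊆ A ∧ t ⊆ A ∧ Disjoint s t ∧ E s ∧ F t

/-- Interpolation between disjoint occurrence and occurrence in independent copies. -/
def DisjPair (E F : Set Site → Prop) (U A A' : Set Site) : Prop :=
  ∃ s t : Set Site, E s ∧ F t ∧ s ⊆ A ∧ t \ U ⊆ A ∧ t ∩ U ⊆ A' ∧ s ∩ t ⊆ U

theorem DisjPair.insert_of {E F : Set Site → Prop} {U A A' s t : Set Site} {i : Site}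
    (hE : E s) (hF : F t) (hsA : s ⊆ A) (htA : t \ U ⊆ A) (htA' : t ∩ U ⊆ A') (hst : s ∩ t ⊆ U)
    (hi : i ∈ t → i ∈ A') : DisjPair E F (insert i U) A A' := by
  refine ⟨s, t, hE, hF, hsA, fun v hv => htA ⟨hv.1, fun h => hv.2 (.inr h)⟩, ?_,
    hst.trans (Set.subset_insert _ _)⟩
  rintro v ⟨hv, rfl | hvU⟩
  · exact hi hv
  · exact htA' ⟨hv, hvU⟩

theorem DisjPair.swap {E F : Set Site → Prop} {U A A' : Set Site} {i : Site} (hi : i ∉ U)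
    (h : DisjPair E F U A A') (h' : ¬ DisjPair E F (insert i U) A A') :
    i ∈ A ∧ i ∉ A' ∧ DisjPair E F (insert i U) (A \ {i}) (insert i A') ∧
      ¬ DisjPair E F U (A \ {i}) (insert i A') := by
  obtain ⟨s, t, hE, hF, hsA, htA, htA', hst⟩ := h
  have h1 : i ∈ t ∧ i ∉ A' := by
    by_contra hcon
    exact h' (DisjPair.insert_of hE hF hsA htA htA' hst (by tauto))
  have his : i ∉ s := fun h => hi (hst ⟨h, h1.1⟩)
  refine ⟨htA ⟨h1.1, hi⟩, h1.2, ⟨s, t, hE, hF, ?_, ?_, ?_, hst.trans (Set.subset_insert _ _)⟩, ?_⟩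
  · exact fun v hv => ⟨hsA hv, fun h => his (by rwa [Set.mem_singleton_iff.1 h] at hv)⟩
  · exact fun v hv => ⟨htA ⟨hv.1, fun h => hv.2 (.inr h)⟩, fun h => hv.2 (.inl h)⟩
  · rintro v ⟨hv, rfl | hvU⟩
    · exact .inl rfl
    · exact .inr (htA' ⟨hv, hvU⟩)
  · rintro ⟨s', t', hE', hF', hsA', htA2, htA2', hst'⟩
    have hit' : i ∉ t' := fun h => (htA2 ⟨h, hi⟩).2 rfl
    refine h' (DisjPair.insert_of hE' hF' (hsA'.trans Set.sdiff_subset)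
      (htA2.trans Set.sdiff_subset) ?_ hst' fun h => absurd h hit')
    intro v hv
    rcases htA2' hv with rfl | h
    · exact absurd hv.1 hit'
    · exact h

theorem card_disjPair_le (Λ : Finset Site) (E F : Set Site → Prop) (U : Finset Site) (i : Site)
    (hi : i ∉ U) (hiΛ : i ∈ Λ) [DecidablePred fun p : Finset Site × Finset Site =>
      DisjPair E F ↑U ↑p.1 ↑p.2] [DecidablePred fun p : Finset Site × Finset Site =>
      DisjPair E F ↑(insert i U) ↑p.1 ↑p.2] :
    ((Λ.powerset ×ˢ Λ.powerset).filter fun p => DisjPair E F ↑U ↑p.1 ↑p.2).card ≤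
      ((Λ.powerset ×ˢ Λ.powerset).filter fun p => DisjPair E F ↑(insert i U) ↑p.1 ↑p.2).card := by
  classical
  set P := (Λ.powerset ×ˢ Λ.powerset).filter fun p => DisjPair E F ↑U ↑p.1 ↑p.2 with hP
  set Q := (Λ.powerset ×ˢ Λ.powerset).filter fun p => DisjPair E F ↑(insert i U) ↑p.1 ↑p.2 with hQ
  have h1 : (P \ Q).card ≤ (Q \ P).card := by
    have hs : ∀ p ∈ P \ Q, i ∈ p.1 ∧ i ∉ p.2 ∧ (p.1.erase i, insert i p.2) ∈ Q \ P := by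
      rintro ⟨A, A'⟩ hp
      simp only [Finset.mem_sdiff, hP, hQ, Finset.mem_filter, Finset.mem_product,
        Finset.mem_powerset, not_and] at hp ⊢
      have := DisjPair.swap (U := ↑U) (by simpa using hi) hp.1.2
        (by simpa using hp.2 hp.1.1)
      refine ⟨by simpa using this.1, by simpa using this.2.1, ⟨⟨⟨?_, ?_⟩, ?_⟩, ?_⟩⟩
      · exact (Finset.erase_subset _ _).trans hp.1.1.1
      · exact Finset.insert_subset hiΛ hp.1.1.2
      · simpa using this.2.2.1
      · intro _; simpa using this.2.2.2
    refine Finset.card_le_card_of_injOn (fun p => (p.1.erase i, insert i p.2))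
      (fun p hp => (hs p hp).2.2) ?_
    rintro ⟨A, A'⟩ hp ⟨B, B'⟩ hq h
    have h1 := hs _ hp
    have h2 := hs _ hq
    simp only [Prod.mk.injEq] at h ⊢
    constructor
    · rw [← Finset.insert_erase (s := A) h1.1, h.1, Finset.insert_erase (s := B) h2.1]
    · rw [← Finset.erase_insert (s := A') h1.2.1, h.2, Finset.erase_insert (s := B') h2.2.1]
  have h2 := Finset.card_sdiff_add_card_inter P Q
  have h3 := Finset.card_sdiff_add_card_inter Q P
  rw [Finset.inter_comm] at h3
  omega

/-- The van den Berg–Kesten inequality for increasing events. -/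
theorem pr_disj_le (hμ : IsBernoulliHalf μ) {S : Set Site} (hS : S.Finite)
    {E F : Set Site → Prop} (hE : Dep S E) (hF : Dep S F) (hE' : Monotone E) (hF' : Monotone F) :
    pr μ (Disj E F) ≤ pr μ E * pr μ F := by
  classical
  lift S to Finset Site using hS
  have hD : Dep ↑S (Disj E F) := by
    rintro A B hAB ⟨s, t, hs, ht, hst, hEs, hFt⟩
    have h0 : A ∩ ↑S ⊆ B := by rw [hAB]; exact Set.inter_subset_left
    refine ⟨s ∩ ↑S, t ∩ ↑S, fun v hv => h0 ⟨hs hv.1, hv.2⟩, fun v hv => h0 ⟨ht hv.1, hv.2⟩,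
      hst.mono Set.inter_subset_left Set.inter_subset_left, hE _ _ ?_ hEs, hF _ _ ?_ hFt⟩ <;>
    rw [Set.inter_assoc, Set.inter_self]
  let P (U : Finset Site) := (S.powerset ×ˢ S.powerset).filter fun p => DisjPair E F ↑U ↑p.1 ↑p.2
  have hstep : ∀ U : Finset Site, U ⊆ S → (P ∅).card ≤ (P U).card := by
    intro U
    induction U using Finset.induction_on with
    | empty => intro _; exact le_rfl
    | insert i U hi ih =>
      intro hU
      exact (ih ((Finset.subset_insert _ _).trans hU)).trans
        (card_disjPair_le S E F U i hi (hU (Finset.mem_insert_self _ _)))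
  have h0 : (P ∅).card = cnt S (Disj E F) * 2 ^ S.card := by
    rw [cnt, ← Finset.card_powerset, ← Finset.card_product]
    congr 1
    ext ⟨A, A'⟩
    simp only [P, Finset.mem_filter, Finset.mem_product, Finset.mem_powerset]
    simp only [DisjPair, Disj, Finset.coe_empty, Set.sdiff_empty, Set.inter_empty, Set.empty_subset, true_and,
      Set.subset_empty_iff, ← Set.disjoint_iff_inter_eq_empty]
    constructor
    · rintro ⟨⟨h1, h2⟩, s, t, h3, h4, h5, h6, h7⟩
      exact ⟨⟨h1, s, t, h5, h6, h7, h3, h4⟩, h2⟩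
    · rintro ⟨⟨h1, s, t, h5, h6, h7, h3, h4⟩, h2⟩
      exact ⟨⟨h1, h2⟩, s, t, h3, h4, h5, h6, h7⟩
  have h1 : (P S).card ≤ cnt S E * cnt S F := by
    rw [cnt, cnt, ← Finset.card_product]
    refine Finset.card_le_card ?_
    rintro ⟨A, A'⟩ h
    simp only [P, Finset.mem_filter, Finset.mem_product, Finset.mem_powerset] at h ⊢
    obtain ⟨⟨h1, h2⟩, s, t, h3, h4, h5, h6, h7, h8⟩ := h
    refine ⟨⟨h1, hE' h5 h3⟩, h2, hF' h7 (hF _ _ ?_ h4)⟩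
    rw [Set.inter_assoc, Set.inter_self]
  rw [pr_eq_cnt hμ hD, pr_eq_cnt hμ hE, pr_eq_cnt hμ hF, div_mul_div_comm,
    div_le_div_iff₀ (by positivity) (by positivity), ← mul_assoc]
  have h2 : ((cnt S (Disj E F) * 2 ^ S.card : ℕ) : ℝ) ≤ ((cnt S E * cnt S F : ℕ) : ℝ) := by
    rw [← h0]; exact_mod_cast (hstep S subset_rfl).trans h1
  push_cast at h2
  gcongr

/-- Exploration: conditionally on one of disjoint events `E i`, an independent event `W i` of
probability at least `δ` forces `X`. -/
theorem pr_exploration (hμ : IsBernoulliHalf μ) {ι : Type*} (I : Finset ι)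
    {E W : ι → Set Site → Prop} {S T : ι → Set Site} {V X : Set Site → Prop} {δ : ℝ}
    (hS : ∀ i ∈ I, (S i).Finite) (hT : ∀ i ∈ I, (T i).Finite)
    (hST : ∀ i ∈ I, (∃ A, E i A) → Disjoint (S i) (T i)) (hE : ∀ i ∈ I, Dep (S i) (E i))
    (hW : ∀ i ∈ I, Dep (T i) (W i))
    (hd : ∀ i ∈ I, ∀ j ∈ I, i ≠ j → ∀ A, E i A → ¬ E j A)
    (hδ : ∀ i ∈ I, (∃ A, E i A) → δ ≤ pr μ (W i)) (hV : ∀ A, V A → ∃ i ∈ I, E i A)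
    (hδ0 : 0 ≤ δ) (hX : ∀ i ∈ I, ∀ A, E i A → W i A → X A) : δ * pr μ V ≤ pr μ X := by
  have h1 : pr μ (fun A => ∃ i ∈ I, E i A ∧ W i A) ≤ pr μ X :=
    pr_mono hμ fun A ⟨i, hi, h1, h2⟩ => hX i hi A h1 h2
  have h2 : pr μ V ≤ ∑ i ∈ I, pr μ (E i) :=
    (pr_mono hμ hV).trans (pr_exists_le_sum I)
  have h3 : pr μ (fun A => ∃ i ∈ I, E i A ∧ W i A) = ∑ i ∈ I, pr μ (fun A => E i A ∧ W i A) := by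
    refine pr_exists_eq_sum hμ I (fun i => S i ∪ T i) (fun i hi => (hS i hi).union (hT i hi))
      (fun i hi => ((hE i hi).mono Set.subset_union_left).and
        ((hW i hi).mono Set.subset_union_right)) ?_
    exact fun i hi j hj hij A h h' => hd i hi j hj hij A h.1 h'.1
  have h4 : ∑ i ∈ I, δ * pr μ (E i) ≤ ∑ i ∈ I, pr μ (fun A => E i A ∧ W i A) := by
    refine Finset.sum_le_sum fun i hi => ?_
    by_cases hne : ∃ A, E i A
    · rw [pr_and_of_disjoint hμ (hS i hi) (hT i hi) (hST i hi hne) (hE i hi) (hW i hi), mul_comm]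
      exact mul_le_mul_of_nonneg_left (hδ i hi hne) (pr_nonneg _)
    · have : pr μ (E i) = 0 := by
        unfold pr
        have : {ω : Config | E i {v | ω v = true}} = ∅ :=
          Set.eq_empty_of_forall_notMem fun ω hω => hne ⟨_, hω⟩
        rw [this, measureReal_empty]
      rw [this, mul_zero]
      exact pr_nonneg _
  rw [← Finset.mul_sum] at h4
  calc δ * pr μ V ≤ δ * ∑ i ∈ I, pr μ (E i) := mul_le_mul_of_nonneg_left h2 hδ0
    _ ≤ _ := h4.trans (h3 ▸ h1)

end Counting

theorem rect_finite (x₀ x₁ y₀ y₁ : ℤ) : (rect x₀ x₁ y₀ y₁).Finite := by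
  refine ((Set.finite_Icc x₀ x₁).prod (Set.finite_Icc y₀ y₁)).subset ?_
  rintro v ⟨h1, h2, h3, h4⟩
  exact ⟨⟨h1, h2⟩, h3, h4⟩

theorem trect_finite (y₀ y₁ c d : ℤ) : (trect y₀ y₁ c d).Finite := by
  refine (rect_finite (-|c| - |y₁|) (|d| + |y₀|) y₀ y₁).subset ?_
  intro v hv
  have h1 := le_abs_self y₁
  have h2 := neg_abs_le y₀
  have h3 := le_abs_self d
  have h4 := neg_abs_le c
  have h5 := abs_nonneg d
  have h6 := abs_nonneg c
  have h7 := abs_nonneg y₀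
  have h8 := abs_nonneg y₁
  simp only [trect, rect, Set.mem_ofPred_eq] at hv ⊢
  omega

theorem dep_horConn (x₀ x₁ y₀ y₁ : ℤ) : Dep (rect x₀ x₁ y₀ y₁) (HorConn x₀ x₁ y₀ y₁) :=
  dep_inter fun B => ∃ a b : Site, Conn B a b ∧ a.1 = x₀ ∧ b.1 = x₁

theorem dep_vertConn (x₀ x₁ y₀ y₁ : ℤ) : Dep (rect x₀ x₁ y₀ y₁) (VertConn x₀ x₁ y₀ y₁) :=
  dep_inter fun B => ∃ a b : Site, Conn B a b ∧ a.2 = y₀ ∧ b.2 = y₁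

theorem dep_tv (y₀ y₁ c d : ℤ) : Dep (trect y₀ y₁ c d) (TV y₀ y₁ c d) :=
  dep_inter fun B => ∃ a b : Site, Conn B a b ∧ a.2 = y₀ ∧ b.2 = y₁

theorem dep_th (y₀ y₁ c d : ℤ) : Dep (trect y₀ y₁ c d) (TH y₀ y₁ c d) :=
  dep_inter fun B => ∃ a b : Site, Conn B a b ∧ 2 * a.1 + a.2 ≤ c + 1 ∧ d - 1 ≤ 2 * b.1 + b.2

theorem monotone_vertConn (x₀ x₁ y₀ y₁ : ℤ) : Monotone (VertConn x₀ x₁ y₀ y₁) :=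
  fun _ _ hAB ⟨a, b, h, h'⟩ => ⟨a, b, h.mono (Set.inter_subset_inter_left _ hAB), h'⟩

theorem monotone_tv (y₀ y₁ c d : ℤ) : Monotone (TV y₀ y₁ c d) :=
  fun _ _ hAB ⟨a, b, h, hcd⟩ => ⟨a, b, h.mono (Set.inter_subset_inter_left _ hAB), hcd⟩

theorem monotone_th (y₀ y₁ c d : ℤ) : Monotone (TH y₀ y₁ c d) :=
  fun _ _ hAB ⟨a, b, h, hcd⟩ => ⟨a, b, h.mono (Set.inter_subset_inter_left _ hAB), hcd⟩

/-- Translation of the lattice. -/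
def siteShift (a b : ℤ) : Site ≃ Site where
  toFun v := (v.1 + a, v.2 + b)
  invFun v := (v.1 - a, v.2 - b)
  left_inv v := by ext <;> simp
  right_inv v := by ext <;> simp

/-- Exchange of the two coordinates. -/
def transpose : Site ≃ Site where
  toFun v := (v.2, v.1)
  invFun v := (v.2, v.1)
  left_inv _ := rfl
  right_inv _ := rfl

/-- Reflection in the horizontal axis of the triangular embedding. -/
def reflectY : Site ≃ Site where
  toFun v := (v.1 + v.2, -v.2)
  invFun v := (v.1 + v.2, -v.2)
  left_inv v := by ext <;> simp
  right_inv v := by ext <;> simp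

/-- Reflection `2x + y ↦ 2s - (2x + y)` of the triangular embedding. -/
def reflectX (s : ℤ) : Site ≃ Site where
  toFun v := (s - v.1 - v.2, v.2)
  invFun v := (s - v.1 - v.2, v.2)
  left_inv v := by ext <;> dsimp only; ring
  right_inv v := by ext <;> dsimp only; ring

/-- Automorphisms of the lattice graph. -/
def IsAut (φ : Site ≃ Site) : Prop := ∀ u v, Adj (φ u) (φ v) ↔ Adj u v

theorem isAut_siteShift (a b : ℤ) : IsAut (siteShift a b) := by
  intro u v; simp only [adj_iff, siteShift, Equiv.coe_fn_mk]; omega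

theorem isAut_transpose : IsAut transpose := by
  intro u v; simp only [adj_iff, transpose, Equiv.coe_fn_mk]; omega

theorem isAut_reflectY : IsAut reflectY := by
  intro u v; simp only [adj_iff, reflectY, Equiv.coe_fn_mk]; omega

theorem isAut_reflectX (s : ℤ) : IsAut (reflectX s) := by
  intro u v; simp only [adj_iff, reflectX, Equiv.coe_fn_mk]; omega

theorem IsAut.conn_preimage {φ : Site ≃ Site} (hφ : IsAut φ) {S : Set Site} {a b : Site} :
    Conn (φ ⁻¹' S) a b ↔ Conn S (φ a) (φ b) := by
  constructor
  · exact fun h => h.map (fun u v => (hφ u v).2) fun v hv => hv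
  · intro h
    have := h.map (φ := φ.symm) (S' := φ ⁻¹' S) (fun u v huv => (hφ _ _).1 (by simpa using huv))
      (fun v hv => by simpa using hv)
    simpa using this

/-- Path events transform under automorphisms. -/
theorem IsAut.exists_conn_iff {φ : Site ≃ Site} (hφ : IsAut φ) {S S' A : Set Site}
    {p q p' q' : Site → Prop} (hS : ∀ v, v ∈ S ↔ φ v ∈ S') (hp : ∀ v ∈ S, p v ↔ p' (φ v))
    (hq : ∀ v ∈ S, q v ↔ q' (φ v)) :
    (∃ a b, Conn (φ ⁻¹' A ∩ S) a b ∧ p a ∧ q b) ↔ ∃ a b, Conn (A ∩ S') a b ∧ p' a ∧ q' b := by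
  have e : φ ⁻¹' A ∩ S = φ ⁻¹' (A ∩ S') := by ext v; simp [hS v]
  rw [e]
  constructor
  · rintro ⟨a, b, h, h1, h2⟩
    have ha := (hS a).2 h.left_mem.2
    have hb := (hS b).2 h.right_mem.2
    exact ⟨_, _, hφ.conn_preimage.1 h, (hp a ha).1 h1, (hq b hb).1 h2⟩
  · rintro ⟨a, b, h, h1, h2⟩
    obtain ⟨a, rfl⟩ := φ.surjective a
    obtain ⟨b, rfl⟩ := φ.surjective b
    have ha := (hS a).2 h.left_mem.2
    have hb := (hS b).2 h.right_mem.2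
    exact ⟨_, _, hφ.conn_preimage.2 h, (hp a ha).2 h1, (hq b hb).2 h2⟩


section

variable {μ : Measure Config}

theorem pr_th_shift (hμ : IsBernoulliHalf μ) {y₀ y₁ c d y₀' y₁' c' d' : ℤ} (a b : ℤ)
    (h₁ : y₀' = y₀ + b) (h₂ : y₁' = y₁ + b) (h₃ : c' = c + 2 * a + b) (h₄ : d' = d + 2 * a + b) :
    pr μ (TH y₀ y₁ c d) = pr μ (TH y₀' y₁' c' d') := by
  rw [← pr_preimage hμ (trect_finite _ _ _ _) (dep_th y₀' y₁' c' d') (siteShift (-a) (-b))]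
  refine pr_congr fun A => ((isAut_siteShift (-a) (-b)).exists_conn_iff (fun v => ?_)
    (fun v _ => ?_) (fun v _ => ?_)).symm <;>
  · simp only [trect, siteShift, Equiv.coe_fn_mk, Set.mem_ofPred_eq]
    omega

theorem pr_horConn_shift (hμ : IsBernoulliHalf μ) {x₀ x₁ y₀ y₁ x₀' x₁' y₀' y₁' : ℤ} (a b : ℤ)
    (h₁ : x₀' = x₀ + a) (h₂ : x₁' = x₁ + a) (h₃ : y₀' = y₀ + b) (h₄ : y₁' = y₁ + b) :
    pr μ (HorConn x₀ x₁ y₀ y₁) = pr μ (HorConn x₀' x₁' y₀' y₁') := by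
  rw [← pr_preimage hμ (rect_finite _ _ _ _) (dep_horConn x₀' x₁' y₀' y₁') (siteShift (-a) (-b))]
  refine pr_congr fun A => ((isAut_siteShift (-a) (-b)).exists_conn_iff (fun v => ?_)
    (fun v _ => ?_) (fun v _ => ?_)).symm <;>
  · simp only [rect, siteShift, Equiv.coe_fn_mk, Set.mem_ofPred_eq]
    omega

theorem pr_vertConn (hμ : IsBernoulliHalf μ) {x₀ x₁ y₀ y₁ : ℤ} (hx : x₀ < x₁) (hy : y₀ ≤ y₁) :
    pr μ (VertConn x₀ x₁ y₀ y₁) = 1 - pr μ (HorConn x₀ x₁ y₀ y₁) := by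
  rw [← pr_not hμ (rect_finite _ _ _ _) (dep_horConn _ _ _ _),
    ← pr_compl hμ (rect_finite _ _ _ _) (dep_vertConn _ _ _ _)]
  exact pr_congr fun A => by rw [horConn_iff hx hy, not_not]

theorem pr_tv (hμ : IsBernoulliHalf μ) {y₀ y₁ c d : ℤ} (hy : y₀ ≤ y₁) (hcd : c + 1 ≤ d) :
    pr μ (TV y₀ y₁ c d) = 1 - pr μ (TH y₀ y₁ c d) := by
  rw [← pr_not hμ (trect_finite _ _ _ _) (dep_th _ _ _ _),
    ← pr_compl hμ (trect_finite _ _ _ _) (dep_tv _ _ _ _)]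
  exact pr_congr fun A => by rw [th_iff hy hcd, not_not]

theorem pr_horConn_square (hμ : IsBernoulliHalf μ) {N : ℤ} (hN : 0 < N) :
    pr μ (HorConn 0 N 0 N) = 1 / 2 := by
  have h1 := pr_vertConn hμ hN hN.le
  have h2 : pr μ (HorConn 0 N 0 N) = pr μ (VertConn 0 N 0 N) := by
    rw [← pr_preimage hμ (rect_finite _ _ _ _) (dep_vertConn 0 N 0 N) transpose]
    refine pr_congr fun A => (isAut_transpose.exists_conn_iff (fun v => ?_) (fun v _ => ?_)
      (fun v _ => ?_)).symm <;>
      simp only [rect, transpose, Equiv.coe_fn_mk, Set.mem_ofPred_eq] <;> omega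
  linarith

/-- Probability of a left-right crossing of the rectangle with `2m + 1` rows and
`2x + y ∈ [0, 2T]`. -/
noncomputable def hh (μ : Measure Config) (m T : ℤ) : ℝ := pr μ (TH 0 (2 * m) 0 (2 * T))

theorem half_le_hh (hμ : IsBernoulliHalf μ) {m : ℤ} (hm : 1 ≤ m) : 1 / 2 ≤ hh μ m m := by
  rw [← pr_horConn_square hμ (N := 2 * m) (by omega), hh,
    pr_th_shift hμ (c' := 2 * m) (d' := 4 * m) m 0 rfl rfl (by omega) (by omega)]
  refine pr_mono hμ fun A ⟨a, b, hab, ha, hb⟩ => ?_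
  have h1 := hab.left_mem.2
  have h2 := hab.right_mem.2
  simp only [rect, Set.mem_ofPred_eq] at h1 h2
  obtain ⟨u, v, huv, hu, hv⟩ := hab.slab (f := fun v => 2 * v.1 + v.2) (k := 2) (lo := 2 * m)
    (hi := 4 * m) (by intro u v h; rw [adj_iff] at h; omega) (by omega) (by omega) (by omega)
  refine ⟨u, v, huv.mono fun z hz => ⟨hz.1.1, ?_⟩, by omega, by omega⟩
  have h1 := hz.1.2
  have h2 := hz.2
  simp only [rect, trect, Set.mem_ofPred_eq] at h1 h2 ⊢
  omega

theorem hh_le_half (hμ : IsBernoulliHalf μ) {m : ℤ} (hm : 1 ≤ m) : hh μ m (3 * m) ≤ 1 / 2 := by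
  have h1 := pr_tv hμ (y₀ := 0) (y₁ := 2 * m) (c := 0) (d := 2 * (3 * m)) (by omega) (by omega)
  have h2 := pr_vertConn hμ (x₀ := 0) (x₁ := 2 * m) (y₀ := 0) (y₁ := 2 * m) (by omega) (by omega)
  rw [pr_horConn_square hμ (by omega)] at h2
  have h3 : pr μ (VertConn 0 (2 * m) 0 (2 * m)) ≤ pr μ (TV 0 (2 * m) 0 (2 * (3 * m))) := by
    refine pr_mono hμ fun A ⟨a, b, hab, ha, hb⟩ => ⟨a, b, hab.mono ?_, ha, hb⟩
    refine Set.inter_subset_inter_right _ fun z hz => ?_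
    simp only [rect, trect, Set.mem_ofPred_eq] at hz ⊢
    omega
  rw [hh]
  linarith

theorem exists_critical (hμ : IsBernoulliHalf μ) {m : ℤ} (hm : 1 ≤ m) :
    ∃ T, m ≤ T ∧ T < 3 * m ∧ 1 / 2 ≤ hh μ m T ∧ hh μ m (T + 1) ≤ 1 / 2 := by
  by_contra! hno
  have key : ∀ n : ℕ, m + n ≤ 3 * m → 1 / 2 ≤ hh μ m (m + n) ∧ (1 ≤ n → 1 / 2 < hh μ m (m + n)) := by
    intro n
    induction n with
    | zero => intro _; simpa using half_le_hh hμ hm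
    | succ n ih =>
      intro h
      push_cast at h ⊢
      have := hno (m + n) (by omega) (by omega) (ih (by omega)).1
      rw [← add_assoc]
      exact ⟨this.le, fun _ => this⟩
  have h1 := (key (2 * m).toNat (by omega)).2 (by omega)
  have h2 := hh_le_half hμ hm
  have h3 : m + ((2 * m).toNat : ℤ) = 3 * m := by omega
  rw [h3] at h1
  linarith

theorem pr_row (hμ : IsBernoulliHalf μ) (Λ : Finset Site) :
    pr μ (fun A => ↑Λ ⊆ A) = (1 / 2) ^ Λ.card := by
  rw [← pr_cylinder hμ Λ Λ subset_rfl]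
  exact pr_congr fun A => Set.inter_eq_right.symm

theorem half_hh_le (hμ : IsBernoulliHalf μ) {m T : ℤ} :
    1 / 2 * hh μ m T ≤ hh μ m (T + 1) := by
  classical
  let S := trect 0 (2 * m) 0 (2 * T)
  let good (B : Set Site) (z : Site) : Prop :=
    ∃ a, Conn B a z ∧ 2 * a.1 + a.2 ≤ 1 ∧ 2 * T - 1 ≤ 2 * z.1 + z.2
  let g (B : Set Site) : Site := if h : ∃ z, good B z then h.choose else (0, 0)
  have hg : ∀ B, (∃ z, good B z) → good B (g B) := by
    intro B hB
    simp only [g, dif_pos hB]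
    exact hB.choose_spec
  have hSf : S.Finite := trect_finite _ _ _ _
  refine pr_exploration hμ hSf.toFinset (E := fun z A => good (A ∩ S) z ∧ g (A ∩ S) = z)
    (W := fun z A => ↑({(z.1 + 1, z.2)} : Finset Site) ⊆ A) (S := fun _ => S)
    (T := fun z => {(z.1 + 1, z.2)}) (fun _ _ => hSf) (fun _ _ => Set.finite_singleton _) ?_ ?_ ?_
    ?_ ?_ ?_ (by norm_num) ?_
  · rintro z hz ⟨A, ⟨a, h1, h2, h3⟩, -⟩
    rw [Set.disjoint_singleton_right]
    intro h
    simp only [S, trect, Set.mem_ofPred_eq] at h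
    omega
  · intro z hz
    exact dep_inter fun B => good B z ∧ g B = z
  · intro z hz A B hAB hA
    simp only [Finset.coe_singleton, Set.singleton_subset_iff] at hA ⊢
    have : ((z.1 + 1, z.2) : Site) ∈ A ∩ {(z.1 + 1, z.2)} := ⟨hA, rfl⟩
    rw [hAB] at this
    exact this.1
  · rintro z _ w _ hzw A ⟨_, h1⟩ ⟨_, h2⟩
    exact hzw (h1.symm.trans h2)
  · intro z _ _
    rw [pr_row hμ]
    simp
  · rintro A ⟨a, b, hab, ha, hb⟩
    have := hg (A ∩ S) ⟨b, a, hab, by omega, hb⟩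
    obtain ⟨c, hc, -⟩ := id this
    exact ⟨g (A ∩ S), hSf.mem_toFinset.2 hc.right_mem.2, this, rfl⟩
  · rintro z hz A ⟨⟨a, h1, h2, h3⟩, -⟩ hW
    simp only [Finset.coe_singleton, Set.singleton_subset_iff] at hW
    have hz2 := h1.right_mem.2
    simp only [S, trect, Set.mem_ofPred_eq] at hz2
    have h4 : Conn (A ∩ trect 0 (2 * m) 0 (2 * (T + 1))) a z := h1.mono <|
      Set.inter_subset_inter_right _ fun v hv => by
        simp only [S, trect, Set.mem_ofPred_eq] at hv ⊢
        omega
    refine ⟨a, (z.1 + 1, z.2), h4.trans (Conn.step h4.right_mem ⟨hW, ?_⟩ ?_), by omega, ?_⟩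
    · simp only [trect, Set.mem_ofPred_eq]; omega
    · rw [adj_iff]; dsimp only; omega
    · dsimp only; omega

end

section Exploration

/-- Complementary sites of `S` joined to the left side of `S` off `A`. -/
def leftCluster (S A : Set Site) : Set Site :=
  {v | ∃ u ∈ S, 2 * u.1 + u.2 ≤ 1 ∧ Conn (Aᶜ ∩ S) u v}

/-- The sites examined when discovering `leftCluster S A`. -/
def explored (S A : Set Site) : Set Site :=
  {v | v ∈ S ∧ (2 * v.1 + v.2 ≤ 1 ∨ v ∈ leftCluster S A ∨ ∃ u ∈ leftCluster S A, Adj u v)}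

variable {S A B : Set Site}

theorem mem_leftCluster_of_mem {v : Site} (hv : v ∈ S) (hA : v ∉ A) (h : 2 * v.1 + v.2 ≤ 1) :
    v ∈ leftCluster S A :=
  ⟨v, hv, h, Conn.refl ⟨hA, hv⟩⟩

theorem leftCluster_subset {v : Site} (h : v ∈ leftCluster S A) : v ∉ A ∧ v ∈ S := by
  obtain ⟨u, -, -, h⟩ := h
  exact h.right_mem

theorem mem_leftCluster_of_adj {u v : Site} (hu : u ∈ leftCluster S A) (huv : Adj u v)
    (hv : v ∈ S) (hA : v ∉ A) : v ∈ leftCluster S A := by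
  obtain ⟨w, hw, h1, h⟩ := hu
  exact ⟨w, hw, h1, h.trans (Conn.step h.right_mem ⟨hA, hv⟩ huv)⟩

theorem leftCluster_subset_explored : leftCluster S A ⊆ explored S A :=
  fun _ hv => ⟨(leftCluster_subset hv).2, .inr (.inl hv)⟩

theorem leftCluster_congr (h : A ∩ explored S A = B ∩ explored S A) :
    leftCluster S A = leftCluster S B := by
  have key : ∀ v ∈ explored S A, v ∈ A ↔ v ∈ B := by
    intro v hv
    have := Set.ext_iff.1 h v
    simp only [Set.mem_inter_iff, hv, and_true] at this
    exact this
  apply Set.Subset.antisymm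
  · rintro v ⟨u, hu, h1, hc⟩
    refine ⟨u, hu, h1, hc.component.mono fun w hw => ?_⟩
    have hw' : w ∈ leftCluster S A := ⟨u, hu, h1, hw⟩
    obtain ⟨h2, h3⟩ := leftCluster_subset hw'
    exact ⟨fun h => h2 ((key w (leftCluster_subset_explored hw')).2 h), h3⟩
  · rintro v ⟨u, hu, h1, hc⟩
    refine hc.induct (p := fun w => w ∈ leftCluster S A) ?_ ?_
    · refine mem_leftCluster_of_mem hu (fun h => hc.left_mem.1 ((key u ⟨hu, .inl h1⟩).1 h)) h1
    · intro w x hw _ hx hwx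
      exact mem_leftCluster_of_adj hw hwx hx.2
        fun h => hx.1 ((key x ⟨hx.2, .inr (.inr ⟨w, hw, hwx⟩)⟩).1 h)

theorem explored_congr (h : A ∩ explored S A = B ∩ explored S A) :
    explored S A = explored S B := by
  unfold explored
  rw [leftCluster_congr h]

theorem TV.explored {y₀ y₁ d : ℤ} (hy : y₀ ≤ y₁) (hd : 1 ≤ d) (h : TV y₀ y₁ 0 d A) :
    TV y₀ y₁ 0 d (A ∩ explored (trect y₀ y₁ 0 d) A) := by
  by_contra hno
  rw [← th_compl hy (by omega)] at hno
  obtain ⟨a, b, hab, ha, hb⟩ := hno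
  rw [← not_not (a := TV y₀ y₁ 0 d A), ← th_compl hy (by omega)] at h
  have h0 : a ∈ leftCluster (trect y₀ y₁ 0 d) A :=
    mem_leftCluster_of_mem hab.left_mem.2
      (fun h => hab.left_mem.1 ⟨h, hab.left_mem.2, .inl (by omega)⟩) (by omega)
  have h1 : b ∈ leftCluster (trect y₀ y₁ 0 d) A := by
    refine hab.induct (p := fun w => w ∈ leftCluster (trect y₀ y₁ 0 d) A) h0 ?_
    intro w x hw _ hx hwx
    exact mem_leftCluster_of_adj hw hwx hx.2
      fun h => hx.1 ⟨h, hx.2, .inr (.inr ⟨w, hw, hwx⟩)⟩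
  obtain ⟨u, hu, h2, huv⟩ := h1
  exact h ⟨u, b, huv, by omega, hb⟩

theorem TH.exists_mem {y₀ y₁ c d : ℤ} (hy : y₀ ≤ y₁) (hcd : c + 1 ≤ d) (h : TH y₀ y₁ c d A)
    (h' : TV y₀ y₁ c d B) : ∃ v, v ∈ A ∧ v ∈ B := by
  by_contra! hno
  rw [th_iff hy hcd] at h
  exact h (monotone_tv _ _ _ _ (fun v hv hvA => hno v hvA hv) h')

end Exploration

section Reflection

/-- A vertical crossing of the lower left part, joined to the right side. -/
def Lower (H D d : ℤ) (A : Set Site) : Prop :=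
  ∃ a b c : Site, Conn (A ∩ trect (-H) 0 0 d) a b ∧ a.2 = -H ∧ b.2 = 0 ∧
    Conn (A ∩ trect (-H) H 0 D) a c ∧ D - 1 ≤ 2 * c.1 + c.2

/-- The path reaching the right side of `R` off `G`, starting next to `Q`. -/
def Exit (R G Q : Set Site) (D : ℤ) (A : Set Site) : Prop :=
  ∃ z ∈ Q, ∃ z', Adj z z' ∧ ∃ c, Conn (A ∩ (R \ G)) z' c ∧ D - 1 ≤ 2 * c.1 + c.2

theorem reflectY_fst (v : Site) : (reflectY v).1 = v.1 + v.2 := rfl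

theorem reflectY_snd (v : Site) : (reflectY v).2 = -v.2 := rfl

theorem reflectY_reflectY (v : Site) : reflectY (reflectY v) = v := reflectY.left_inv v

theorem reflectY_of_snd_eq_zero {v : Site} (h : v.2 = 0) : reflectY v = v := by
  ext
  · rw [reflectY_fst, h, add_zero]
  · rw [reflectY_snd, h, neg_zero]

theorem reflectY_mem_trect {H D : ℤ} {v : Site} :
    reflectY v ∈ trect (-H) H 0 D ↔ v ∈ trect (-H) H 0 D := by
  simp only [trect, Set.mem_ofPred_eq, reflectY_fst, reflectY_snd]
  omega

theorem Exit.reflect {H D : ℤ} {e A : Set Site}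
    (h : Exit (trect (-H) H 0 D) (e ∪ reflectY ⁻¹' e) (reflectY ⁻¹' e) D A) :
    Exit (trect (-H) H 0 D) (e ∪ reflectY ⁻¹' e) e D (reflectY ⁻¹' A) := by
  obtain ⟨z, hz, z', hzz, c, hc, hD⟩ := h
  refine ⟨reflectY z, hz, reflectY z', (isAut_reflectY _ _).2 hzz, reflectY c,
    hc.map (fun u v => (isAut_reflectY u v).2) ?_, ?_⟩
  · rintro v ⟨hA, hR, hG⟩
    refine ⟨by simpa [reflectY_reflectY] using hA, reflectY_mem_trect.2 hR, fun h => hG ?_⟩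
    rcases h with h | h
    · exact .inr h
    · exact .inl (by simpa [reflectY_reflectY] using h)
  · rw [reflectY_fst, reflectY_snd]; omega

theorem TH.exit {H D d : ℤ} {e A : Set Site} (hd : 1 ≤ d) (hdD : d + 2 ≤ D)
    (he : e ⊆ trect (-H) 0 0 d) (he' : ∀ v ∈ trect (-H) 0 0 d, 2 * v.1 + v.2 ≤ 1 → v ∈ e)
    (h : TH (-H) H 0 D A) :
    Exit (trect (-H) H 0 D) (e ∪ reflectY ⁻¹' e) e D A ∨
      Exit (trect (-H) H 0 D) (e ∪ reflectY ⁻¹' e) (reflectY ⁻¹' e) D A := by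
  obtain ⟨a, b, hab, ha, hb⟩ := h
  have ha' := hab.left_mem.2
  have haG : a ∈ e ∪ reflectY ⁻¹' e := by
    rcases le_total a.2 0 with h | h
    · refine .inl (he' a ?_ (by omega))
      simp only [trect, Set.mem_ofPred_eq] at ha' ⊢
      omega
    · refine .inr (he' (reflectY a) ?_ ?_)
      · simp only [trect, Set.mem_ofPred_eq, reflectY_fst, reflectY_snd] at ha' ⊢
        omega
      · rw [reflectY_fst, reflectY_snd]; omega
  have hbG : b ∉ e ∪ reflectY ⁻¹' e := by
    rintro (h | h) <;>
    · have := he h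
      simp only [trect, Set.mem_ofPred_eq, reflectY_fst, reflectY_snd] at this
      omega
  obtain ⟨z, hz, z', hzz, hc⟩ := hab.last_exit haG hbG
  rw [show (A ∩ trect (-H) H 0 D) \ (e ∪ reflectY ⁻¹' e) =
    A ∩ (trect (-H) H 0 D \ (e ∪ reflectY ⁻¹' e)) by
      ext v; simp only [Set.mem_sdiff, Set.mem_inter_iff, and_assoc]] at hc
  exact hz.imp (fun hz => ⟨z, hz, z', hzz, b, hc, hb⟩) fun hz => ⟨z, hz, z', hzz, b, hc, hb⟩

theorem Exit.lower {H D d : ℤ} {A : Set Site} (hH : 0 ≤ H) (hd : 1 ≤ d) (hdD : d + 2 ≤ D)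
    {e : Set Site} (he : explored (trect (-H) 0 0 d) A = e) (hV : TV (-H) 0 0 d (A ∩ e))
    (h : Exit (trect (-H) H 0 D) (e ∪ reflectY ⁻¹' e) e D A) : Lower H D d A := by
  obtain ⟨p, q, hpq, hp, hq⟩ := hV
  obtain ⟨z, hz, z', hzz, c, hc, hD⟩ := h
  set S := trect (-H) 0 0 d with hS
  set R := trect (-H) H 0 D with hR
  have hSR : S ⊆ R := by
    intro v hv
    simp only [hS, hR, trect, Set.mem_ofPred_eq] at hv ⊢
    omega
  have heS : e ⊆ S := by rw [← he]; exact fun v hv => hv.1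
  set P : Set Site := {v | Conn (A ∩ e ∩ S) p v} with hP
  set Q : Set Site := {v | Conn (A ∩ (R \ (e ∪ reflectY ⁻¹' e))) z' v} with hQ
  have hPm : ∀ v ∈ P, v ∈ A ∧ v ∈ e ∧ v ∈ S := fun v hv => by
    obtain ⟨⟨h1, h2⟩, h3⟩ := Conn.right_mem hv
    exact ⟨h1, h2, h3⟩
  have hQm : ∀ v ∈ Q, v ∈ A ∧ v ∈ R ∧ v ∉ e ∧ reflectY v ∉ e := fun v hv => by
    obtain ⟨h1, h2, h3⟩ := Conn.right_mem hv
    exact ⟨h1, h2, fun h => h3 (.inl h), fun h => h3 (.inr h)⟩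
  suffices hzP : z ∈ P by
    refine ⟨p, q, c, hpq.mono fun v hv => ⟨hv.1.1, hv.2⟩, hp, hq, ?_, hD⟩
    have h1 : Conn (A ∩ R) p z := Conn.mono hzP fun v hv => ⟨hv.1.1, hSR hv.2⟩
    have h2 : Conn (A ∩ R) z' c := hc.mono fun v hv => ⟨hv.1, hv.2.1⟩
    exact (h1.trans (Conn.step h1.right_mem h2.left_mem hzz)).trans h2
  have hTV : TV (-H) H 0 D (P ∪ reflectY ⁻¹' P) := by
    have h1 : Conn ((P ∪ reflectY ⁻¹' P) ∩ R) p q :=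
      hpq.component.mono fun v hv => ⟨.inl hv, hSR (hPm v hv).2.2⟩
    have h2 : Conn ((P ∪ reflectY ⁻¹' P) ∩ R) (reflectY p) (reflectY q) := by
      refine hpq.component.map (fun u v => (isAut_reflectY u v).2) fun v hv => ⟨.inr ?_, ?_⟩
      · rwa [Set.mem_preimage, reflectY_reflectY]
      · exact reflectY_mem_trect.2 (hSR (hPm v hv).2.2)
    rw [reflectY_of_snd_eq_zero hq] at h2
    exact ⟨p, reflectY p, h1.trans h2.symm, hp, by rw [reflectY_snd]; omega⟩
  have hTH : TH (-H) H 0 D (leftCluster S A ∪ {z} ∪ Q) := by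
    set κ := leftCluster S A ∪ {z} ∪ Q with hκ
    have hzκ : z ∈ κ ∩ R := ⟨.inl (.inr rfl), hSR (heS hz)⟩
    have hcl : ∀ v ∈ leftCluster S A, ∃ u, Conn (κ ∩ R) u v ∧ 2 * u.1 + u.2 ≤ 1 := by
      rintro v ⟨u, hu, h1, huv⟩
      refine ⟨u, huv.component.mono fun w hw => ?_, h1⟩
      exact ⟨.inl (.inl ⟨u, hu, h1, hw⟩), hSR (Conn.right_mem hw).2⟩
    have h1 : ∃ u, Conn (κ ∩ R) u z ∧ 2 * u.1 + u.2 ≤ 1 := by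
      have hz' := hz
      rw [← he] at hz'
      obtain ⟨-, h | h | ⟨u, hu, huz⟩⟩ := hz'
      · exact ⟨z, Conn.refl hzκ, h⟩
      · exact hcl z h
      · obtain ⟨w, hw, h⟩ := hcl u hu
        exact ⟨w, hw.trans (Conn.step hw.right_mem hzκ huz), h⟩
    have h2 : Conn (κ ∩ R) z' c := hc.component.mono fun v hv => ⟨.inr hv, (hQm v hv).2.1⟩
    obtain ⟨u, hu, h⟩ := h1
    exact ⟨u, c, (hu.trans (Conn.step hu.right_mem h2.left_mem hzz)).trans h2, by omega, hD⟩
  have hfix : ∀ v ∈ S, reflectY v ∈ P → v ∈ P := by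
    intro v hv h
    have h1 := (hPm _ h).2.2
    have : v.2 = 0 := by
      simp only [hS, trect, Set.mem_ofPred_eq, reflectY_fst, reflectY_snd] at hv h1
      omega
    rwa [reflectY_of_snd_eq_zero this] at h
  obtain ⟨v, hv, hv'⟩ := hTH.exists_mem (by omega) (by omega) hTV
  have hvS : v ∉ Q → v ∈ S := by
    intro h
    rcases hv with (h1 | rfl) | h1
    · exact (leftCluster_subset h1).2
    · exact heS hz
    · exact absurd h1 h
  have hvP : v ∈ P := by
    rcases hv' with h | h
    · exact h
    · refine hfix v (hvS fun hQ' => ?_) h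
      exact (hQm v hQ').2.2.2 (hPm _ h).2.1
  rcases hv with (h1 | rfl) | h1
  · exact absurd (hPm v hvP).1 (leftCluster_subset h1).1
  · exact hvP
  · exact absurd (hPm v hvP).2.1 (hQm v h1).2.2.1

theorem dep_explored (S : Set Site) (F : Set Site → Prop) (e : Set Site) :
    Dep e fun A => explored S A = e ∧ F (A ∩ e) := by
  rintro A B hAB ⟨rfl, hF⟩
  exact ⟨(explored_congr hAB).symm, hAB ▸ hF⟩

theorem dep_exit (R G Q : Set Site) (D : ℤ) : Dep (R \ G) (Exit R G Q D) := by
  rintro A B hAB ⟨z, hz, z', hzz, c, hc, hD⟩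
  exact ⟨z, hz, z', hzz, c, hAB ▸ hc, hD⟩

theorem pr_lower {μ : Measure Config} (hμ : IsBernoulliHalf μ) {H D d : ℤ} (hH : 0 ≤ H)
    (hd : 1 ≤ d) (hdD : d + 2 ≤ D) :
    pr μ (TH (-H) H 0 D) / 2 * pr μ (TV (-H) 0 0 d) ≤ pr μ (Lower H D d) := by
  have hSf : (trect (-H) 0 0 d).Finite := trect_finite _ _ _ _
  have hRf : (trect (-H) H 0 D).Finite := trect_finite _ _ _ _
  refine pr_exploration hμ hSf.finite_subsets.toFinset
    (E := fun e A => explored (trect (-H) 0 0 d) A = e ∧ TV (-H) 0 0 d (A ∩ e))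
    (W := fun e => Exit (trect (-H) H 0 D) (e ∪ reflectY ⁻¹' e) e D)
    (S := fun e => e) (T := fun e => trect (-H) H 0 D \ (e ∪ reflectY ⁻¹' e)) ?_ ?_ ?_ ?_ ?_ ?_ ?_
    ?_ (by have := pr_nonneg (μ := μ) (TH (-H) H 0 D); linarith) ?_
  · intro e he
    exact hSf.subset (by simpa using he)
  · intro e _
    exact hRf.subset Set.sdiff_subset
  · rintro e - -
    exact Set.disjoint_left.2 fun v hv h => h.2 (.inl hv)
  · intro e _
    exact dep_explored _ _ _
  · intro e _
    exact dep_exit _ _ _ _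
  · rintro e - f - hef A ⟨h1, -⟩ ⟨h2, -⟩
    exact hef (h1.symm.trans h2)
  · rintro e - ⟨A, hA, -⟩
    have h1 : pr μ (TH (-H) H 0 D) ≤
        pr μ (Exit (trect (-H) H 0 D) (e ∪ reflectY ⁻¹' e) e D) +
        pr μ (Exit (trect (-H) H 0 D) (e ∪ reflectY ⁻¹' e) (reflectY ⁻¹' e) D) := by
      refine (pr_mono hμ fun B hB => hB.exit hd hdD ?_ ?_).trans (pr_or_le _ _)
      · rw [← hA]; exact fun v hv => hv.1
      · rw [← hA]; exact fun v hv h => ⟨hv, .inl h⟩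
    have h2 : pr μ (Exit (trect (-H) H 0 D) (e ∪ reflectY ⁻¹' e) (reflectY ⁻¹' e) D) ≤
        pr μ (Exit (trect (-H) H 0 D) (e ∪ reflectY ⁻¹' e) e D) := by
      rw [← pr_preimage hμ (hRf.subset Set.sdiff_subset)
        (dep_exit (trect (-H) H 0 D) (e ∪ reflectY ⁻¹' e) e D) reflectY]
      exact pr_mono hμ fun B hB => hB.reflect
    linarith
  · intro A hA
    refine ⟨explored (trect (-H) 0 0 d) A, hSf.finite_subsets.mem_toFinset.2 fun v hv => hv.1, rfl, ?_⟩
    exact hA.explored (by omega) hd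
  · rintro e - A ⟨h1, h2⟩ h3
    exact h3.lower hH hd hdD h1 h2

end Reflection

section Glue

variable {A : Set Site} {y₀ y₁ c d : ℤ} {a b u v : Site}

/-- A vertical and a horizontal crossing of the same rectangle are connected. -/
theorem Conn.crossing (hy : y₀ ≤ y₁) (hcd : c + 1 ≤ d) (hab : Conn (A ∩ trect y₀ y₁ c d) a b)
    (ha : a.2 = y₀) (hb : b.2 = y₁) (huv : Conn (A ∩ trect y₀ y₁ c d) u v)
    (hu : 2 * u.1 + u.2 ≤ c + 1) (hv : d - 1 ≤ 2 * v.1 + v.2) :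
    Conn (A ∩ trect y₀ y₁ c d) a u := by
  have h1 : TV y₀ y₁ c d {w | Conn (A ∩ trect y₀ y₁ c d) a w} :=
    ⟨a, b, hab.component.mono fun w hw => ⟨hw, (Conn.right_mem hw).2⟩, ha, hb⟩
  have h2 : TH y₀ y₁ c d {w | Conn (A ∩ trect y₀ y₁ c d) u w} :=
    ⟨u, v, huv.component.mono fun w hw => ⟨hw, (Conn.right_mem hw).2⟩, hu, hv⟩
  obtain ⟨w, hw, hw'⟩ := h2.exists_mem hy hcd h1
  exact Conn.trans hw' (Conn.symm hw)

end Glue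

section Double

variable {H D s : ℤ} {A : Set Site}

theorem reflectX_fst (v : Site) : (reflectX s v).1 = s - v.1 - v.2 := rfl

theorem reflectX_snd (v : Site) : (reflectX s v).2 = v.2 := rfl

theorem Lower.glue (hH : 0 ≤ H) (hs : 1 ≤ s) (hD : 2 * s ≤ D) (h : Lower H D (2 * s) A)
    (h' : Lower H D (2 * s) (reflectX s ⁻¹' A)) (hA : TH (-H) 0 0 (2 * s) A) :
    TH (-H) H (2 * s - D) D A := by
  obtain ⟨a, b, c, hab, ha, hb, hac, hc⟩ := h
  obtain ⟨a', b', c', hab', ha', hb', hac', hc'⟩ := h'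
  obtain ⟨u, v, huv, hu, hv⟩ := hA
  have hφ := fun u v => (isAut_reflectX s u v).2
  have h1 : Conn (A ∩ trect (-H) 0 0 (2 * s)) (reflectX s a') (reflectX s b') := by
    refine hab'.map hφ fun v hv => ⟨hv.1, ?_⟩
    have := hv.2
    simp only [trect, Set.mem_ofPred_eq, reflectX_fst, reflectX_snd] at this ⊢
    omega
  have h2 : Conn (A ∩ trect (-H) H (2 * s - D) D) (reflectX s a') (reflectX s c') := by
    refine hac'.map hφ fun v hv => ⟨hv.1, ?_⟩
    have := hv.2
    simp only [trect, Set.mem_ofPred_eq, reflectX_fst, reflectX_snd] at this ⊢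
    omega
  have h3 : Conn (A ∩ trect (-H) H (2 * s - D) D) a c := by
    refine hac.mono fun v hv => ⟨hv.1, ?_⟩
    have := hv.2
    simp only [trect, Set.mem_ofPred_eq] at this ⊢
    omega
  have h4 := hab.crossing (by omega) (by omega) ha hb huv hu hv
  have h5 := h1.crossing (by omega) (by omega) ha' hb' huv hu hv
  have h6 : Conn (A ∩ trect (-H) H (2 * s - D) D) (reflectX s a') a := by
    refine (h5.trans h4.symm).mono fun v hv => ⟨hv.1, ?_⟩
    have := hv.2
    simp only [trect, Set.mem_ofPred_eq] at this ⊢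
    omega
  refine ⟨_, c, h2.symm.trans (h6.trans h3), ?_, hc⟩
  rw [reflectX_fst, reflectX_snd]
  omega

theorem monotone_lower (H D d : ℤ) : Monotone (Lower H D d) :=
  fun _ _ hAB ⟨a, b, c, h1, ha, hb, h2, hc⟩ =>
    ⟨a, b, c, h1.mono (Set.inter_subset_inter_left _ hAB), ha, hb,
      h2.mono (Set.inter_subset_inter_left _ hAB), hc⟩

theorem dep_lower (H D d : ℤ) :
    Dep (trect (-H) 0 0 d ∪ trect (-H) H 0 D) (Lower H D d) := by
  have h := (dep_inter (S := trect (-H) 0 0 d ∪ trect (-H) H 0 D) (Lower H D d))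
  intro A B hAB hA
  have key : ∀ A : Set Site, Lower H D d (A ∩ (trect (-H) 0 0 d ∪ trect (-H) H 0 D)) ↔
      Lower H D d A := by
    intro A
    unfold Lower
    rw [Set.inter_assoc, Set.inter_assoc, Set.inter_eq_right.2 Set.subset_union_left,
      Set.inter_eq_right.2 Set.subset_union_right]
  exact (key B).1 (h A B hAB ((key A).2 hA))

variable {μ : Measure Config}

theorem hh_double (hμ : IsBernoulliHalf μ) {m T : ℤ} (hm : 0 ≤ m) (hs : 1 ≤ s) (hsT : s + 1 ≤ T) :
    (hh μ (2 * m) T / 2 * (1 - hh μ m s)) ^ 2 * hh μ m s ≤ hh μ (2 * m) (2 * T - s) := by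
  have h1 := pr_lower hμ (H := 2 * m) (D := 2 * T) (d := 2 * s) (by omega) (by omega) (by omega)
  rw [pr_tv hμ (by omega) (by omega)] at h1
  have e1 : pr μ (TH (-(2 * m)) 0 0 (2 * s)) = hh μ m s :=
    pr_th_shift hμ (-m) (2 * m) (by omega) (by omega) (by omega) (by omega)
  have e2 : pr μ (TH (-(2 * m)) (2 * m) 0 (2 * T)) = hh μ (2 * m) T :=
    pr_th_shift hμ (-m) (2 * m) (by omega) (by omega) (by omega) (by omega)
  have e3 : pr μ (TH (-(2 * m)) (2 * m) (2 * s - 2 * T) (2 * T)) = hh μ (2 * m) (2 * T - s) :=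
    pr_th_shift hμ (T - s - m) (2 * m) (by omega) (by omega) (by omega) (by omega)
  rw [e1, e2] at h1
  set L := Lower (2 * m) (2 * T) (2 * s) with hL
  set U := trect (-(2 * m)) 0 0 (2 * s) ∪ trect (-(2 * m)) (2 * m) 0 (2 * T) with hU
  have hUf : U.Finite := (trect_finite _ _ _ _).union (trect_finite _ _ _ _)
  have hdL : Dep U L := dep_lower _ _ _
  have h0 : pr μ (fun A => L (reflectX s ⁻¹' A)) = pr μ L := pr_preimage hμ hUf hdL (reflectX s)
  have hVf : (U ∪ reflectX s '' U).Finite := hUf.union (hUf.image _)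
  have hm1 : Monotone L := monotone_lower _ _ _
  have hm2 : Monotone fun A => L (reflectX s ⁻¹' A) :=
    fun A B hAB => hm1 (Set.preimage_mono hAB)
  have d1 : Dep (U ∪ reflectX s '' U) L := hdL.mono Set.subset_union_left
  have d2 : Dep (U ∪ reflectX s '' U) fun A => L (reflectX s ⁻¹' A) :=
    (hdL.preimage _).mono Set.subset_union_right
  have d3 : Dep (U ∪ reflectX s '' U) (TH (-(2 * m)) 0 0 (2 * s)) :=
    (dep_th _ _ _ _).mono (Set.subset_union_left.trans Set.subset_union_left)
  have h2 := pr_mul_le_and hμ hVf d1 d2 hm1 hm2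
  have h3 := pr_mul_le_and hμ hVf (d1.and d2) d3 (fun A B hAB h => ⟨hm1 hAB h.1, hm2 hAB h.2⟩)
    (monotone_th _ _ _ _)
  rw [h0] at h2
  rw [e1] at h3
  have h4 := pr_mono hμ (E := fun A => (L A ∧ L (reflectX s ⁻¹' A)) ∧ TH (-(2 * m)) 0 0 (2 * s) A)
    (F := TH (-(2 * m)) (2 * m) (2 * s - 2 * T) (2 * T)) fun A hA =>
      Lower.glue (by omega) hs (by omega) hA.1.1 hA.1.2 hA.2
  rw [e3] at h4
  have h5 : 0 ≤ hh μ (2 * m) T := pr_nonneg _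
  have h6 : 0 ≤ hh μ m s := pr_nonneg _
  have h7 : hh μ m s ≤ 1 := pr_le_one hμ _
  refine le_trans ?_ (h3.trans h4)
  refine mul_le_mul_of_nonneg_right (le_trans ?_ h2) h6
  rw [sq]
  have h8 : 0 ≤ hh μ (2 * m) T / 2 * (1 - hh μ m s) := by
    have : 0 ≤ 1 - hh μ m s := by linarith
    positivity
  exact mul_le_mul h1 h1 h8 (pr_nonneg _)

/-- Gluing two horizontal crossings along a vertical one. -/
theorem hh_extend (hμ : IsBernoulliHalf μ) {m T ℓ : ℤ} (hm : 0 ≤ m) (hT : 1 ≤ T) (hTℓ : T ≤ ℓ)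
    (hh2 : hh μ m T ≤ 1 / 2) : hh μ m ℓ ^ 2 / 2 ≤ hh μ m (2 * ℓ - T) := by
  set k := ℓ - T with hk
  have e1 : pr μ (TH 0 (2 * m) (2 * k) (2 * k + 2 * ℓ)) = hh μ m ℓ :=
    pr_th_shift hμ (-k) 0 (by omega) (by omega) (by omega) (by omega)
  have e2 : pr μ (TV 0 (2 * m) (2 * k) (2 * ℓ)) = 1 - hh μ m T := by
    rw [pr_tv hμ (by omega) (by omega)]
    congr 1
    exact pr_th_shift hμ (-k) 0 (by omega) (by omega) (by omega) (by omega)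
  set U := trect 0 (2 * m) 0 (2 * k + 2 * ℓ) with hU
  have hUf : U.Finite := trect_finite _ _ _ _
  have d1 : Dep U (TH 0 (2 * m) 0 (2 * ℓ)) := (dep_th _ _ _ _).mono fun v hv => by
    simp only [hU, trect, Set.mem_ofPred_eq] at hv ⊢; omega
  have d2 : Dep U (TH 0 (2 * m) (2 * k) (2 * k + 2 * ℓ)) := (dep_th _ _ _ _).mono fun v hv => by
    simp only [hU, trect, Set.mem_ofPred_eq] at hv ⊢; omega
  have d3 : Dep U (TV 0 (2 * m) (2 * k) (2 * ℓ)) := (dep_tv _ _ _ _).mono fun v hv => by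
    simp only [hU, trect, Set.mem_ofPred_eq] at hv ⊢; omega
  have h2 := pr_mul_le_and hμ hUf d1 d2 (monotone_th _ _ _ _) (monotone_th _ _ _ _)
  have h3 := pr_mul_le_and hμ hUf (d1.and d2) d3
    (fun A B hAB h => ⟨monotone_th _ _ _ _ hAB h.1, monotone_th _ _ _ _ hAB h.2⟩)
    (monotone_tv _ _ _ _)
  rw [e1] at h2
  rw [e2] at h3
  have h4 : pr μ (fun A => (TH 0 (2 * m) 0 (2 * ℓ) A ∧ TH 0 (2 * m) (2 * k) (2 * k + 2 * ℓ) A) ∧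
      TV 0 (2 * m) (2 * k) (2 * ℓ) A) ≤ pr μ (TH 0 (2 * m) 0 (2 * (2 * ℓ - T))) := by
    refine pr_mono hμ fun A ⟨⟨⟨a, b, hab, ha, hb⟩, ⟨a', b', hab', ha', hb'⟩⟩,
      ⟨u, v, huv, hu, hv⟩⟩ => ?_
    have h1 : Conn (A ∩ U) a u := by
      refine (Conn.crossing (A := A) (b := v) (by omega) (by omega) (huv.mono ?_) hu hv
          hab ha hb).symm.mono ?_ <;>
      · intro w hw
        refine ⟨hw.1, ?_⟩
        have := hw.2
        simp only [hU, trect, Set.mem_ofPred_eq] at this ⊢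
        omega
    have h2 : Conn (A ∩ U) u b' := by
      refine ((Conn.crossing (A := A) (b := v) (by omega) (by omega) (huv.mono ?_) hu hv
          hab' ha' hb').trans hab').mono ?_ <;>
      · intro w hw
        refine ⟨hw.1, ?_⟩
        have := hw.2
        simp only [hU, trect, Set.mem_ofPred_eq] at this ⊢
        omega
    refine ⟨a, b', (h1.trans h2).mono fun w hw => ⟨hw.1, ?_⟩, ha, by omega⟩
    have := hw.2
    simp only [hU, trect, Set.mem_ofPred_eq] at this ⊢
    omega
  have h5 : 0 ≤ hh μ m ℓ := pr_nonneg _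
  change hh μ m ℓ * hh μ m ℓ ≤ _ at h2
  change _ ≤ hh μ m (2 * ℓ - T) at h4
  nlinarith [h3.trans h4, pr_nonneg (μ := μ) (fun A => TH 0 (2 * m) 0 (2 * ℓ) A ∧
    TH 0 (2 * m) (2 * k) (2 * k + 2 * ℓ) A)]

end Double

section RSW

variable {μ : Measure Config}

/-- Lower bounds for iterated gluing. -/
noncomputable def glueBound : ℕ → ℝ
  | 0 => 1 / 256
  | n + 1 => glueBound n ^ 2 / 2

theorem glueBound_pos (n : ℕ) : 0 < glueBound n := by
  induction n with
  | zero => norm_num [glueBound]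
  | succ n ih => unfold glueBound; positivity

theorem hh_iterate (hμ : IsBernoulliHalf μ) {m T x : ℤ} (hm : 0 ≤ m) (hT : 1 ≤ T) (hx : 0 ≤ x)
    (hh2 : hh μ m T ≤ 1 / 2) (h : 1 / 256 ≤ hh μ m (T + x)) (n : ℕ) :
    glueBound n ≤ hh μ m (T + 2 ^ n * x) := by
  induction n with
  | zero => simpa [glueBound] using h
  | succ n ih =>
    have h0 : 0 ≤ 2 ^ n * x := by positivity
    have h1 := hh_extend hμ hm hT (ℓ := T + 2 ^ n * x) (by omega) hh2
    have h2 : 2 * (T + 2 ^ n * x) - T = T + 2 ^ (n + 1) * x := by ring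
    rw [h2] at h1
    refine le_trans ?_ h1
    unfold glueBound
    have := glueBound_pos n
    gcongr

theorem exists_long_crossing (hμ : IsBernoulliHalf μ) {m : ℤ} (hm : 40 ≤ m) :
    ∃ M ℓ, 2 * m ≤ M ∧ M ≤ 4 * m ∧ 50 * M ≤ ℓ ∧ glueBound 10 ≤ hh μ M ℓ := by
  obtain ⟨T₁, a₁, b₁, c₁, d₁⟩ := exists_critical hμ (m := m) (by omega)
  obtain ⟨T₂, a₂, b₂, c₂, d₂⟩ := exists_critical hμ (m := 2 * m) (by omega)
  obtain ⟨T₄, a₄, b₄, c₄, d₄⟩ := exists_critical hμ (m := 2 * (2 * m)) (by omega)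
  have key : ∀ m T T' : ℤ, 40 ≤ m → m ≤ T → 2 * m ≤ T' → 1 / 2 ≤ hh μ m T →
      hh μ m (T + 1) ≤ 1 / 2 → 1 / 2 ≤ hh μ (2 * m) T' → hh μ (2 * m) (T' + 1) ≤ 1 / 2 →
      23 * T ≤ 20 * T' → ∃ ℓ, 50 * (2 * m) ≤ ℓ ∧ glueBound 10 ≤ hh μ (2 * m) ℓ := by
    intro m T T' hm hT hT' h1 h2 h3 h4 h5
    have h6 := hh_double hμ (m := m) (s := T + 1) (T := T') (by omega) (by omega) (by omega)
    have h7 := half_hh_le hμ (m := m) (T := T)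
    have h8 : 1 / 256 ≤ hh μ (2 * m) ((T' + 1) + (T' - T - 2)) := by
      rw [show (T' + 1) + (T' - T - 2) = 2 * T' - (T + 1) by ring]
      refine le_trans ?_ h6
      have h9 : 1 / 8 ≤ hh μ (2 * m) T' / 2 * (1 - hh μ m (T + 1)) := by nlinarith
      calc (1 : ℝ) / 256 = (1 / 8) ^ 2 * (1 / 4) := by norm_num
        _ ≤ _ := by
          apply mul_le_mul _ (by linarith) (by norm_num) (by positivity)
          gcongr
    refine ⟨_, ?_, hh_iterate hμ (by omega) (by omega) (by omega) h4 h8 10⟩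
    norm_num
    omega
  by_cases h : 23 * T₁ ≤ 20 * T₂
  · obtain ⟨ℓ, h1, h2⟩ := key m T₁ T₂ hm a₁ a₂ c₁ d₁ c₂ d₂ h
    exact ⟨2 * m, ℓ, le_rfl, by omega, h1, h2⟩
  · obtain ⟨ℓ, h1, h2⟩ := key (2 * m) T₂ T₄ (by omega) a₂ a₄ c₂ d₂ c₄ d₄ (by omega)
    exact ⟨_, ℓ, by omega, by omega, h1, h2⟩

theorem TH.horConn {M ℓ w k : ℤ} {A : Set Site} (hw : 0 ≤ w) (hwℓ : w ≤ ℓ - M) (hk : 2 * M ≤ k)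
    (h : TH 0 (2 * M) 0 (2 * ℓ) A) : HorConn 0 w 0 k A := by
  obtain ⟨a, b, hab, ha, hb⟩ := h
  have ha' := hab.left_mem.2
  have hb' := hab.right_mem.2
  simp only [trect, Set.mem_ofPred_eq] at ha' hb'
  obtain ⟨u, v, huv, hu, hv⟩ := hab.slab (f := fun v => v.1) (k := 1) (lo := 0) (hi := w)
    (by intro u v h; rw [adj_iff] at h; omega) (by omega) (by omega) (by omega)
  have hu' := huv.left_mem.2
  have hv' := huv.right_mem.2
  simp only [Set.mem_ofPred_eq] at hu' hv'
  refine ⟨u, v, huv.mono fun z hz => ⟨hz.1.1, ?_⟩, by omega, by omega⟩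
  have h1 := hz.1.2
  have h2 := hz.2
  simp only [trect, rect, Set.mem_ofPred_eq] at h1 h2 ⊢
  omega

theorem pr_horConn_ge_pow (hμ : IsBernoulliHalf μ) {w k : ℤ} (hw : 0 ≤ w) (hk : 0 ≤ k) :
    (1 / 2) ^ (w.toNat + 1) ≤ pr μ (HorConn 0 w 0 k) := by
  have h := pr_row hμ ((Finset.Icc (0 : ℤ) w).map ⟨fun x => ((x, 0) : Site), fun x y h => by
    simpa using h⟩)
  rw [Finset.card_map, Int.card_Icc] at h
  rw [show w.toNat + 1 = (w + 1 - 0).toNat by omega, ← h]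
  refine pr_mono hμ fun A hA => ⟨(0, 0), (w, 0), Conn.row_le hw fun i h0 h1 => ⟨hA ?_, ?_⟩,
    rfl, rfl⟩
  · exact Finset.mem_coe.2 (Finset.mem_map.2 ⟨i, Finset.mem_Icc.2 ⟨h0, h1⟩, rfl⟩)
  · simp [rect, h0, h1, hk]

/-- Russo–Seymour–Welsh: rectangles of bounded aspect ratio are crossed in the long direction
with probability bounded below. -/
theorem exists_rsw : ∃ c : ℝ, 0 < c ∧ ∀ μ : Measure Config, IsBernoulliHalf μ → ∀ w k : ℤ,
    0 ≤ w → 0 ≤ k → w ≤ 8 * (k + 1) → c ≤ pr μ (HorConn 0 w 0 k) := by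
  refine ⟨min (glueBound 10) ((1 / 2) ^ 2561), lt_min (glueBound_pos _) (by positivity), ?_⟩
  intro μ hμ w k hw hk hwk
  by_cases h : k < 320
  · refine (min_le_right _ _).trans (le_trans ?_ (pr_horConn_ge_pow hμ hw hk))
    exact pow_le_pow_of_le_one (by norm_num) (by norm_num) (by omega)
  · obtain ⟨M, ℓ, h1, h2, h3, h4⟩ := exists_long_crossing hμ (m := k / 8) (by omega)
    refine (min_le_left _ _).trans (h4.trans (pr_mono hμ fun A hA => ?_))
    exact hA.horConn hw (by omega) (by omega)

end RSW

section DisjointPowers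

variable {μ : Measure Config}

theorem sum_pr_le (hμ : IsBernoulliHalf μ) {ι κ : Type} {I : Finset ι} {K : Finset κ}
    {E : ι → Set Site → Prop} {F : κ → Set Site → Prop} {S : Set Site} (hS : S.Finite)
    (hE : ∀ i ∈ I, Dep S (E i)) (hF : ∀ i ∈ K, Dep S (F i))
    (h : ∀ A, {i | i ∈ I ∧ E i A}.ncard ≤ {i | i ∈ K ∧ F i A}.ncard) :
    ∑ i ∈ I, pr μ (E i) ≤ ∑ i ∈ K, pr μ (F i) := by
  classical
  have := hμ.1
  have key : ∀ {α : Type} (L : Finset α) (G : α → Set Site → Prop), (∀ i ∈ L, Dep S (G i)) →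
      Integrable (fun ω : Config => ∑ i ∈ L,
        {ω : Config | G i {v | ω v = true}}.indicator (fun _ => (1 : ℝ)) ω) μ ∧
      ∑ i ∈ L, pr μ (G i) = ∫ ω : Config, ∑ i ∈ L,
        {ω : Config | G i {v | ω v = true}}.indicator (fun _ => (1 : ℝ)) ω ∂μ := by
    intro α L G hG
    have hi : ∀ i ∈ L, Integrable
        ({ω : Config | G i {v | ω v = true}}.indicator (fun _ => (1 : ℝ))) μ :=
      fun i hi => (integrable_const 1).indicator (measurableSet_of_dep hS (hG i hi))
    refine ⟨integrable_finsetSum _ hi, ?_⟩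
    rw [integral_finsetSum _ hi]
    refine Finset.sum_congr rfl fun i hi => ?_
    rw [integral_indicator_const _ (measurableSet_of_dep hS (hG i hi)), smul_eq_mul, mul_one, pr]
  have count : ∀ {α : Type} (L : Finset α) (G : α → Set Site → Prop) (ω : Config),
      ∑ i ∈ L, {ω : Config | G i {v | ω v = true}}.indicator (fun _ => (1 : ℝ)) ω =
        ({i | i ∈ L ∧ G i {v | ω v = true}}.ncard : ℝ) := by
    intro α L G ω
    simp only [Set.indicator_apply, Set.mem_ofPred_eq]
    rw [← Finset.sum_filter, Finset.sum_const, nsmul_eq_mul, mul_one, ← Set.ncard_coe_finset]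
    simp only [Finset.coe_filter]
  rw [(key I E hE).2, (key K F hF).2]
  refine integral_mono (key I E hE).1 (key K F hF).1 fun ω => ?_
  simp only [count]
  exact_mod_cast h _

/-- `m` disjoint occurrences of `V`. -/
def DisjPow (V : Set Site → Prop) : ℕ → Set Site → Prop
  | 0 => fun _ => True
  | m + 1 => Disj V (DisjPow V m)

theorem monotone_disj (E F : Set Site → Prop) : Monotone (Disj E F) :=
  fun _ _ hAB ⟨s, t, hs, ht, h⟩ => ⟨s, t, hs.trans hAB, ht.trans hAB, h⟩

theorem Dep.disj {S : Set Site} {E F : Set Site → Prop} (hE : Dep S E) (hF : Dep S F) :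
    Dep S (Disj E F) := by
  rintro A B hAB ⟨s, t, hs, ht, hst, hEs, hFt⟩
  have h0 : A ∩ S ⊆ B := by rw [hAB]; exact Set.inter_subset_left
  refine ⟨s ∩ S, t ∩ S, fun v hv => h0 ⟨hs hv.1, hv.2⟩, fun v hv => h0 ⟨ht hv.1, hv.2⟩,
    hst.mono Set.inter_subset_left Set.inter_subset_left, hE _ _ ?_ hEs, hF _ _ ?_ hFt⟩ <;>
  rw [Set.inter_assoc, Set.inter_self]

theorem monotone_disjPow (V : Set Site → Prop) (m : ℕ) : Monotone (DisjPow V m) := by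
  cases m with
  | zero => exact fun _ _ _ _ => trivial
  | succ m => exact monotone_disj _ _

theorem Dep.disjPow {S : Set Site} {V : Set Site → Prop} (hV : Dep S V) (m : ℕ) :
    Dep S (DisjPow V m) := by
  induction m with
  | zero => exact fun _ _ _ _ => trivial
  | succ m ih => exact hV.disj ih

theorem pr_disjPow_le (hμ : IsBernoulliHalf μ) {S : Set Site} (hS : S.Finite)
    {V : Set Site → Prop} (hV : Dep S V) (hV' : Monotone V) (m : ℕ) :
    pr μ (DisjPow V m) ≤ pr μ V ^ m := by
  induction m with
  | zero => simpa using pr_le_one hμ _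
  | succ m ih =>
    rw [pow_succ']
    exact (pr_disj_le hμ hS hV (hV.disjPow m) hV' (monotone_disjPow V m)).trans
      (mul_le_mul_of_nonneg_left ih (pr_nonneg _))

theorem disjPow_of_family {ι : Type*} {V : Set Site → Prop} (I : Finset ι) (B : ι → Set Site)
    (hd : ∀ i ∈ I, ∀ j ∈ I, i ≠ j → Disjoint (B i) (B j)) (hV : ∀ i ∈ I, V (B i)) {X : Set Site}
    (hX : ∀ i ∈ I, B i ⊆ X) : DisjPow V I.card X := by
  classical
  induction I using Finset.induction_on generalizing X with
  | empty => exact trivial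
  | insert j I hj ih =>
    rw [Finset.card_insert_of_notMem hj]
    refine ⟨B j, ⋃ i ∈ I, B i, hX j (Finset.mem_insert_self _ _),
      Set.iUnion₂_subset fun i hi => hX i (Finset.mem_insert_of_mem hi), ?_,
      hV j (Finset.mem_insert_self _ _), ih (fun i hi k hk => hd i (Finset.mem_insert_of_mem hi) k
        (Finset.mem_insert_of_mem hk)) (fun i hi => hV i (Finset.mem_insert_of_mem hi))
        fun i hi => Set.subset_iUnion₂ (s := fun i _ => B i) i hi⟩
    rw [Set.disjoint_iUnion₂_right]
    exact fun i hi => hd j (Finset.mem_insert_self _ _) i (Finset.mem_insert_of_mem hi)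
      fun h => hj (h ▸ hi)

end DisjointPowers

section Lowest

variable {x₀ x₁ L : ℤ} {A : Set Site}

/-- The rows `j, …, j + L` are crossed but not the rows `j + 1, …, j + L`. -/
def Drop (x₀ x₁ L j : ℤ) (A : Set Site) : Prop :=
  HorConn x₀ x₁ j (j + L) A ∧ ¬ HorConn x₀ x₁ (j + 1) (j + L) A

theorem HorConn.mono_rows {y₀ y₁ y₀' y₁' : ℤ} (h : HorConn x₀ x₁ y₀ y₁ A) (h0 : y₀' ≤ y₀)
    (h1 : y₁ ≤ y₁') : HorConn x₀ x₁ y₀' y₁' A := by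
  obtain ⟨a, b, hab, h⟩ := h
  exact ⟨a, b, hab.mono fun v hv => ⟨hv.1, hv.2.1, hv.2.2.1, h0.trans hv.2.2.2.1,
    hv.2.2.2.2.trans h1⟩, h⟩

theorem Conn.vertConn {S : Set Site} {a b : Site} {y₀ y₁ : ℤ} (hy : y₀ ≤ y₁) (h : Conn S a b)
    (ha : a.2 ≤ y₀) (hb : y₁ ≤ b.2) (hS : ∀ v ∈ S, v ∈ A ∧ x₀ ≤ v.1 ∧ v.1 ≤ x₁) :
    VertConn x₀ x₁ y₀ y₁ A := by
  obtain ⟨u, v, huv, hu, hv⟩ := h.slab (f := fun v => v.2) (k := 1) (lo := y₀) (hi := y₁)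
    (by intro u v h; rw [adj_iff] at h; omega) (by omega) (by omega) (by omega)
  have hu' := huv.left_mem.2.1
  have hv' := huv.right_mem.2.2
  refine ⟨u, v, huv.mono fun w hw => ?_, le_antisymm (Int.lt_add_one_iff.1 hu) hu',
    le_antisymm hv' (Int.sub_one_lt_iff.1 hv)⟩
  obtain ⟨h1, h2, h3⟩ := hS w hw.1
  exact ⟨h1, h2, h3, hw.2⟩

theorem exists_drop (N : ℕ) (h : HorConn x₀ x₁ 0 L A) (h' : ¬ HorConn x₀ x₁ N (N + L) A) :
    ∃ j ∈ Finset.range N, Drop x₀ x₁ L j A := by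
  by_contra! hno
  refine h' ?_
  have key : ∀ M : ℕ, M ≤ N → HorConn x₀ x₁ M (M + L) A := by
    intro M
    induction M with
    | zero => intro _; simpa using h
    | succ M ih =>
      intro hM
      have h1 := ih (by omega)
      have h2 : HorConn x₀ x₁ (M + 1) (M + L) A := by
        by_contra h2
        exact hno M (Finset.mem_range.2 (by omega)) ⟨h1, h2⟩
      exact h2.mono_rows (by push_cast; omega) (by push_cast; omega)
  exact key N le_rfl

theorem disjPow_of_drop (hx : x₀ < x₁) {J : ℕ} (hJ : J ≤ L) (I : Finset ℕ)
    (hI : ∀ j ∈ I, j < J ∧ Drop x₀ x₁ L j A) :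
    DisjPow (VertConn x₀ x₁ J L) I.card Aᶜ := by
  have hV : ∀ j ∈ I, ∃ a b : Site, Conn (Aᶜ ∩ rect x₀ x₁ 1 (J + L)) a b ∧ a.2 = j + 1 ∧
      b.2 = j + L := by
    intro j hj
    obtain ⟨h1, -, h3⟩ := hI j hj
    rw [horConn_iff hx (by omega), not_not] at h3
    obtain ⟨a, b, hab, ha, hb⟩ := h3
    refine ⟨a, b, hab.mono fun v hv => ⟨hv.1, ?_⟩, ha, hb⟩
    have := hv.2
    simp only [rect, Set.mem_ofPred_eq] at this ⊢
    omega
  choose! a b hab ha hb using hV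
  have key : ∀ i ∈ I, ∀ j ∈ I, i < j → ¬ Conn (Aᶜ ∩ rect x₀ x₁ 1 (J + L)) (a i) (b j) := by
    intro i hi j hj hij h
    have h1 := (hI j hj).2.1
    rw [horConn_iff hx (by omega)] at h1
    refine h1 (h.vertConn (by omega) (by rw [ha i hi]; omega) (by rw [hb j hj]) ?_)
    exact fun v hv => ⟨hv.1, hv.2.1, hv.2.2.1⟩
  have hdis : ∀ i ∈ I, ∀ j ∈ I, i < j →
      Disjoint {v | Conn (Aᶜ ∩ rect x₀ x₁ 1 (J + L)) (a i) v}
        {v | Conn (Aᶜ ∩ rect x₀ x₁ 1 (J + L)) (a j) v} := fun i hi j hj hij =>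
    Set.disjoint_left.2 fun v hv hv' =>
      key i hi j hj hij ((Conn.trans hv (Conn.symm hv')).trans (hab j hj))
  refine disjPow_of_family I (fun j => {v | Conn (Aᶜ ∩ rect x₀ x₁ 1 (J + L)) (a j) v}) ?_ ?_ ?_
  · intro i hi j hj hij
    rcases lt_or_gt_of_ne hij with h | h
    · exact hdis i hi j hj h
    · exact (hdis j hj i hi h).symm
  · intro j hj
    have := (hI j hj).1
    refine (hab j hj).component.vertConn hJ (by rw [ha j hj]; omega) (by rw [hb j hj]; omega) ?_
    intro v hv
    have h1 := (Conn.right_mem hv).2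
    exact ⟨hv, h1.1, h1.2.1⟩
  · exact fun j hj v hv => (Conn.right_mem hv).1

theorem dep_drop (j : ℤ) : Dep (rect x₀ x₁ j (j + L)) (Drop x₀ x₁ L j) :=
  have h : Dep (rect x₀ x₁ j (j + L)) (HorConn x₀ x₁ (j + 1) (j + L)) :=
    (dep_horConn _ _ _ _).mono fun v hv => by
      simp only [rect, Set.mem_ofPred_eq] at hv ⊢; omega
  (dep_horConn _ _ _ _).and h.not

variable {μ : Measure Config}

theorem pr_drop (hμ : IsBernoulliHalf μ) (j j' : ℤ) :
    pr μ (Drop x₀ x₁ L j) = pr μ (Drop x₀ x₁ L j') := by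
  have key : ∀ j, pr μ (Drop x₀ x₁ L j) = pr μ (HorConn x₀ x₁ 0 L) - pr μ (HorConn x₀ x₁ 1 L) := by
    intro j
    have h1 : pr μ (HorConn x₀ x₁ j (j + L)) = pr μ (HorConn x₀ x₁ 0 L) :=
      pr_horConn_shift hμ 0 (-j) (by omega) (by omega) (by omega) (by omega)
    have h2 : pr μ (HorConn x₀ x₁ (j + 1) (j + L)) = pr μ (HorConn x₀ x₁ 1 L) :=
      pr_horConn_shift hμ 0 (-j) (by omega) (by omega) (by omega) (by omega)
    rw [← h1, ← h2]
    have hμ' := hμ.1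
    unfold pr
    rw [← measureReal_sdiff]
    · rfl
    · exact fun ω hω => HorConn.mono_rows hω (by omega) le_rfl
    · exact measurableSet_of_dep (rect_finite _ _ _ _) (dep_horConn _ _ _ _)
  rw [key j, key j']

theorem mul_pr_drop_ge (hμ : IsBernoulliHalf μ) (hL : 0 ≤ L) :
    pr μ (HorConn x₀ x₁ 0 L) * (1 - pr μ (HorConn x₀ x₁ 0 L)) ≤
      (L + 1) * pr μ (Drop x₀ x₁ L 0) := by
  lift L to ℕ using hL
  have h1 : pr μ (fun A => HorConn x₀ x₁ 0 L A ∧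
      ¬ HorConn x₀ x₁ (L + 1 : ℕ) ((L + 1 : ℕ) + L) A) =
      pr μ (HorConn x₀ x₁ 0 L) * (1 - pr μ (HorConn x₀ x₁ 0 L)) := by
    rw [pr_and_of_disjoint hμ (rect_finite _ _ _ _) (rect_finite _ _ _ _) ?_
      (dep_horConn _ _ _ _) (dep_horConn _ _ _ _).not, pr_not hμ (rect_finite _ _ _ _)
      (dep_horConn _ _ _ _)]
    · congr 2
      exact pr_horConn_shift hμ 0 (-(L + 1 : ℕ)) (by omega) (by omega) (by omega) (by omega)
    · refine Set.disjoint_left.2 fun v hv hv' => ?_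
      have h1 := hv.2.2.2
      have h2 := hv'.2.2.1
      push_cast at h2
      omega
  rw [← h1]
  refine (pr_mono hμ fun A hA => exists_drop (L + 1) hA.1 hA.2).trans
    ((pr_exists_le_sum _).trans ?_)
  have hs : ∑ j ∈ Finset.range (L + 1), pr μ (Drop x₀ x₁ L (j : ℤ)) =
      ∑ j ∈ Finset.range (L + 1), pr μ (Drop x₀ x₁ L 0) :=
    Finset.sum_congr rfl fun j _ => pr_drop hμ _ _
  refine hs.le.trans ?_
  simp

theorem mul_pr_drop_le (hμ : IsBernoulliHalf μ) (hx : x₀ < x₁) {J : ℕ} (hJ : J ≤ L) {c : ℝ}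
    (hc : 0 < c) (h : c ≤ pr μ (HorConn x₀ x₁ J L)) : J * pr μ (Drop x₀ x₁ L 0) ≤ 1 / c := by
  set q := pr μ (VertConn x₀ x₁ J L) with hq
  have hq1 : q ≤ 1 - c := by
    rw [hq, pr_vertConn hμ hx hJ]; linarith
  have hq0 : 0 ≤ q := pr_nonneg _
  have hS : (rect x₀ x₁ 0 (J + L)).Finite := rect_finite _ _ _ _
  have hdV : Dep (rect x₀ x₁ 0 (J + L)) (VertConn x₀ x₁ J L) :=
    (dep_vertConn _ _ _ _).mono fun v hv => by
      simp only [rect, Set.mem_ofPred_eq] at hv ⊢; omega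
  have h1 : ∑ j ∈ Finset.range J, pr μ (Drop x₀ x₁ L j) ≤
      ∑ m ∈ Finset.range J, pr μ (fun A => DisjPow (VertConn x₀ x₁ J L) (m + 1) Aᶜ) := by
    refine sum_pr_le hμ hS (fun j hj => (dep_drop (j : ℤ)).mono fun v hv => ?_)
      (fun m _ => (hdV.disjPow _).compl) fun A => ?_
    · rw [Finset.mem_range] at hj
      simp only [rect, Set.mem_ofPred_eq] at hv ⊢
      omega
    · classical
      have hfin : {i | i ∈ Finset.range J ∧ Drop x₀ x₁ L i A}.Finite :=
        (Finset.range J).finite_toSet.subset fun i hi => hi.1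
      obtain ⟨I, hI⟩ := hfin.exists_finset_coe
      have hmem : ∀ j ∈ I, j ∈ Finset.range J ∧ Drop x₀ x₁ L j A := fun j hj => by
        rw [← Finset.mem_coe, hI] at hj
        exact hj
      have hIJ : I.card ≤ J := by
        simpa using Finset.card_le_card (fun j hj => (hmem j hj).1 : I ⊆ Finset.range J)
      rw [← hI, Set.ncard_coe_finset]
      calc I.card = (↑(Finset.range I.card) : Set ℕ).ncard := by
            rw [Set.ncard_coe_finset, Finset.card_range]
        _ ≤ _ := by
          refine Set.ncard_le_ncard ?_
            ((Finset.range J).finite_toSet.subset fun i hi => hi.1)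
          intro m hm
          rw [Finset.mem_coe, Finset.mem_range] at hm
          refine ⟨Finset.mem_range.2 (by omega), ?_⟩
          obtain ⟨I', hI', hcard⟩ := Finset.exists_subset_card_eq (s := I) (n := m + 1) hm
          rw [← hcard]
          exact disjPow_of_drop hx hJ I' fun j hj =>
            ⟨Finset.mem_range.1 (hmem j (hI' hj)).1, (hmem j (hI' hj)).2⟩
  have h2 : ∑ m ∈ Finset.range J, pr μ (fun A => DisjPow (VertConn x₀ x₁ J L) (m + 1) Aᶜ) ≤
      ∑ m ∈ Finset.range J, q ^ m := by
    refine Finset.sum_le_sum fun m _ => ?_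
    rw [pr_compl hμ hS (hdV.disjPow _)]
    refine (pr_disjPow_le hμ hS hdV (monotone_vertConn _ _ _ _) _).trans ?_
    exact pow_le_pow_of_le_one hq0 (by linarith) (by omega)
  have h3 := mul_neg_geom_sum q J
  have hs : ∑ j ∈ Finset.range J, pr μ (Drop x₀ x₁ L (j : ℤ)) =
      ∑ j ∈ Finset.range J, pr μ (Drop x₀ x₁ L 0) := Finset.sum_congr rfl fun j _ => pr_drop hμ _ _
  rw [hs, Finset.sum_const, Finset.card_range, nsmul_eq_mul] at h1
  refine (h1.trans h2).trans ?_
  rw [le_div_iff₀ hc]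
  have h4 : 0 ≤ ∑ m ∈ Finset.range J, q ^ m := Finset.sum_nonneg fun m _ => pow_nonneg hq0 m
  nlinarith [pow_nonneg hq0 J]

/-- Two-sided bound on the probability that the lowest row is needed. -/
theorem exists_pr_drop_bounds : ∃ c : ℝ, 0 < c ∧ c ≤ 1 ∧ ∀ μ : Measure Config, IsBernoulliHalf μ →
    ∀ n L : ℤ, 1 ≤ n → n ≤ L → L ≤ 2 * n →
      c / 6 / n ≤ pr μ (Drop (-n) n L 0) ∧ pr μ (Drop (-n) n L 0) ≤ 2 / c / n := by
  obtain ⟨c, hc, h⟩ := exists_rsw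
  refine ⟨min c 1, lt_min hc one_pos, min_le_right _ _, fun μ hμ n L hn hnL hL => ?_⟩
  have hc' : 0 < min c 1 := lt_min hc one_pos
  have hn' : (1 : ℝ) ≤ n := by exact_mod_cast hn
  have hL' : (L : ℝ) ≤ 2 * n := by exact_mod_cast hL
  have hp : 0 ≤ pr μ (Drop (-n) n L 0) := pr_nonneg _
  have shift : ∀ y₀ y₁ : ℤ, pr μ (HorConn (-n) n y₀ y₁) = pr μ (HorConn 0 (2 * n) 0 (y₁ - y₀)) :=
    fun y₀ y₁ => pr_horConn_shift hμ n (-y₀) (by omega) (by omega) (by omega) (by omega)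
  constructor
  · have h1 := mul_pr_drop_ge hμ (x₀ := -n) (x₁ := n) (L := L) (by omega)
    have h2 : min c 1 ≤ pr μ (HorConn (-n) n 0 L) := by
      rw [shift]
      exact (min_le_left _ _).trans (h μ hμ _ _ (by omega) (by omega) (by omega))
    have h3 : pr μ (HorConn (-n) n 0 L) ≤ 1 / 2 := by
      rw [shift, ← pr_horConn_square hμ (N := 2 * n) (by omega)]
      exact pr_mono hμ fun A hA => hA.mono_rows le_rfl (by omega)
    have h4 : min c 1 * (1 / 2) ≤
        pr μ (HorConn (-n) n 0 L) * (1 - pr μ (HorConn (-n) n 0 L)) :=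
      mul_le_mul h2 (by linarith) (by norm_num) (pr_nonneg _)
    rw [div_le_iff₀ (by linarith)]
    nlinarith
  · have h1 := mul_pr_drop_le hμ (x₀ := -n) (x₁ := n) (L := L) (J := ((L + 1) / 2).toNat)
      (by omega) (by omega) hc' (by
        rw [shift]
        exact (min_le_left _ _).trans (h μ hμ _ _ (by omega) (by omega) (by omega)))
    have h2 : (n : ℝ) ≤ 2 * ((L + 1) / 2).toNat := by
      have : n ≤ 2 * (((L + 1) / 2).toNat : ℤ) := by omega
      exact_mod_cast this
    rw [le_div_iff₀ (by linarith), show 2 / min c 1 = 2 * (1 / min c 1) by ring]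
    nlinarith

end Lowest

section Lists

theorem Conn.exists_isPath {S : Set Site} {a b : Site} (h : Conn S a b) :
    ∃ p, PathIn S p ∧ p.head? = some a ∧ p.getLast? = some b := by
  refine h.symm.induct (p := fun u => ∃ p, PathIn S p ∧ p.head? = some u ∧ p.getLast? = some b)
    ⟨[b], ⟨⟨by simp, by simp, List.isChain_singleton _⟩, by simpa using h.right_mem⟩, rfl, rfl⟩ ?_
  rintro u v ⟨p, ⟨⟨h1, h2, h3⟩, h4⟩, h5, h6⟩ hu hv huv
  by_cases hvp : v ∈ p
  · obtain ⟨s, t, rfl⟩ := List.append_of_mem hvp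
    refine ⟨v :: t, ⟨⟨by simp, h2.of_append_right, h3.right_of_append⟩, fun w hw => h4 w ?_⟩,
      rfl, ?_⟩
    · exact List.mem_append_right _ hw
    · rwa [List.getLast?_append_of_ne_nil _ (by simp)] at h6
  · refine ⟨v :: p, ⟨⟨by simp, List.nodup_cons.2 ⟨hvp, h2⟩, ?_⟩, ?_⟩, rfl, ?_⟩
    · refine List.isChain_cons.2 ⟨fun w hw => ?_, h3⟩
      rw [h5] at hw
      obtain rfl := Option.some_injective _ hw
      exact huv.symm
    · exact fun w hw => (List.mem_cons.1 hw).elim (fun h => h ▸ hv) (h4 w)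
    · rw [← h6, List.getLast?_cons_of_ne_nil h1]

theorem conn_of_chain {S : Set Site} {p : List Site} (hp : p.IsChain Adj) (hS : ∀ v ∈ p, v ∈ S)
    {a b : Site} (ha : p.head? = some a) (hb : p.getLast? = some b) : Conn S a b := by
  induction p generalizing a with
  | nil => simp at ha
  | cons c p ih =>
    obtain rfl : c = a := by simpa using ha
    cases p with
    | nil =>
      obtain rfl : c = b := by simpa using hb
      exact Conn.refl (hS _ (by simp))
    | cons d p =>
      rw [List.isChain_cons_cons] at hp
      have := ih hp.2 (fun v hv => hS v (List.mem_cons_of_mem _ hv)) rfl (by simpa using hb)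
      exact (Conn.step (hS _ (by simp)) this.left_mem hp.1).trans this

theorem exists_horizCrossing_iff {x₀ x₁ y₀ y₁ : ℤ} {ω : Config} :
    (∃ p, HorizCrossing x₀ x₁ y₀ y₁ ω p) ↔ HorConn x₀ x₁ y₀ y₁ {v | ω v = true} := by
  constructor
  · rintro ⟨p, ⟨⟨-, -, h1⟩, h2⟩, h3, ⟨a, ha, h4⟩, ⟨b, hb, h5⟩⟩
    exact ⟨a, b, conn_of_chain (S := {v | ω v = true} ∩ rect x₀ x₁ y₀ y₁) h1
      (fun v hv => ⟨h3 v hv, h2 v hv⟩) h4 h5, ha.2, hb.2⟩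
  · rintro ⟨a, b, hab, ha, hb⟩
    obtain ⟨p, ⟨h1, h2⟩, h3, h4⟩ := hab.exists_isPath
    exact ⟨p, ⟨h1, fun v hv => (h2 v hv).2⟩, fun v hv => (h2 v hv).1,
      ⟨a, ⟨hab.left_mem.2, ha⟩, h3⟩, ⟨b, ⟨hab.right_mem.2, hb⟩, h4⟩⟩

end Lists

/-- There exist constants `0 < c ≤ C < ∞` such that for all integers `n ≥ 1`
and all integers `-n ≤ h ≤ 0`, `c/n ≤ p(h) ≤ C/n`, where `p(h)` is the
probability that there is a horizontal open crossing of `[-n,n] × [h,n]` but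
no horizontal open crossing of `[-n,n] × [h+1,n]`. -/
theorem statement18 :
    ∃ c C : ℝ≥0∞, 0 < c ∧ c ≤ C ∧ C < ⊤ ∧
      ∀ μ : Measure Config, IsBernoulliHalf μ →
        ∀ n : ℕ, 1 ≤ n → ∀ h : ℤ, -(n : ℤ) ≤ h → h ≤ 0 →
          c / (n : ℝ≥0∞) ≤
              μ {ω | (∃ p, HorizCrossing (-(n : ℤ)) n h n ω p) ∧
                  ¬ ∃ p, HorizCrossing (-(n : ℤ)) n (h + 1) n ω p} ∧
            μ {ω | (∃ p, HorizCrossing (-(n : ℤ)) n h n ω p) ∧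
                  ¬ ∃ p, HorizCrossing (-(n : ℤ)) n (h + 1) n ω p} ≤
              C / (n : ℝ≥0∞) := by
  obtain ⟨c, hc, hc1, H⟩ := exists_pr_drop_bounds
  refine ⟨ENNReal.ofReal (c / 6), ENNReal.ofReal (2 / c), by simpa using hc,
    ENNReal.ofReal_le_ofReal ?_, ENNReal.ofReal_lt_top, fun μ hμ n hn h h0 h1 => ?_⟩
  · rw [le_div_iff₀ hc]
    nlinarith
  have hμ' := hμ.1
  have hn0 : (0 : ℝ) < n := by exact_mod_cast hn
  obtain ⟨h2, h3⟩ := H μ hμ n (n - h) (by exact_mod_cast hn) (by omega) (by omega)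
  rw [pr_drop hμ 0 h] at h2 h3
  have e : {ω | (∃ p, HorizCrossing (-(n : ℤ)) n h n ω p) ∧
      ¬ ∃ p, HorizCrossing (-(n : ℤ)) n (h + 1) n ω p} =
      {ω : Config | Drop (-n) n (n - h) h {v | ω v = true}} := by
    ext ω
    simp only [Set.mem_ofPred_eq, exists_horizCrossing_iff, Drop, add_sub_cancel]
  have e1 : μ {ω : Config | Drop (-n) n (n - h) h {v | ω v = true}} =
      ENNReal.ofReal (pr μ (Drop (-n) n (n - h) h)) :=
    (ENNReal.ofReal_toReal (measure_ne_top _ _)).symm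
  rw [e, e1, ← ENNReal.ofReal_natCast, ← ENNReal.ofReal_div_of_pos hn0,
    ← ENNReal.ofReal_div_of_pos hn0]
  exact ⟨ENNReal.ofReal_le_ofReal h2, ENNReal.ofReal_le_ofReal h3⟩
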